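/- arXiv:2203.03772 — 10 statements merged into one kernel-verified Lean document; each statement's English description precedes it below -/
import Mathlib

section
/- For every finite simple graph G, every simple graph H and every integer ℓ ≥ 1, the following are equivalent: (1) there is an injective map f : V(G) → V(H) × ℕ × Fin ℓ such that for every edge uv of G, writing f(u) = (x, i, s) and f(v) = (y, j, t), one has (x = y or xy ∈ E(H)) and |i − j| ≤ 1 (i.e. G is isomorphic to a subgraph of H ⊠ P ⊠ K_ℓ where P is the one-way infinite path on ℕ and ⊠ is the strong product); (2) there exist a layering (L_0, L_1, …) of G and a partition 𝒫 of V(G) into nonempty parts such that the quotient G/𝒫 is isomorphic to a subgraph of H and |A ∩ L_i| ≤ ℓ for every part A ∈ 𝒫 and every layer L_i. -/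
/-- For a finite graph `G`, a graph `H` and `ℓ ≥ 1`:
`G` is isomorphic to a subgraph of `H ⊠ P ⊠ K_ℓ` (for the one-way infinite path `P` on `ℕ`)
iff `G` has a layering `lay` and a partition (encoded by `P : V → W`; its parts are the
nonempty fibres of `P`, and the quotient maps injectively into `H`, adjacency-preservingly)
of width at most `ℓ`. -/
theorem stmt_0 {V W : Type} [Fintype V] (G : SimpleGraph V) (H : SimpleGraph W)
    (ℓ : ℕ) (hℓ : 1 ≤ ℓ) :
    (∃ f : V → W × ℕ × Fin ℓ, Function.Injective f ∧
      ∀ u v : V, G.Adj u v →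
        ((f u).1 = (f v).1 ∨ H.Adj (f u).1 (f v).1) ∧
        |((f u).2.1 : ℤ) - ((f v).2.1 : ℤ)| ≤ 1) ↔
    (∃ (lay : V → ℕ) (P : V → W),
      (∀ u v : V, G.Adj u v → |((lay u : ℤ)) - ((lay v : ℤ))| ≤ 1) ∧
      (∀ u v : V, G.Adj u v → P u ≠ P v → H.Adj (P u) (P v)) ∧
      (∀ (x : W) (i : ℕ), Set.ncard {v : V | P v = x ∧ lay v = i} ≤ ℓ)) := by
  constructor
  · rintro ⟨f, hf, h⟩
    refine ⟨fun v => (f v).2.1, fun v => (f v).1, fun u v e => (h u v e).2,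
      fun u v e hne => (h u v e).1.resolve_left hne, fun x i => ?_⟩
    have key : Set.ncard {v : V | (f v).1 = x ∧ (f v).2.1 = i} ≤
        Set.ncard (Set.univ : Set (Fin ℓ)) := by
      refine Set.ncard_le_ncard_of_injOn (fun v => (f v).2.2) (fun _ _ => Set.mem_univ _) ?_
        Set.finite_univ
      rintro u ⟨hu1, hu2⟩ v ⟨hv1, hv2⟩ huv
      exact hf (Prod.ext (hu1.trans hv1.symm) (Prod.ext (hu2.trans hv2.symm) huv))
    simpa [Set.ncard_univ] using key
  · rintro ⟨lay, P, h1, h2, h3⟩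
    have key : ∀ (x : W) (i : ℕ), ∃ g : {v : V | P v = x ∧ lay v = i} → Fin ℓ,
        Function.Injective g := by
      intro x i
      classical
      haveI : Fintype {v : V | P v = x ∧ lay v = i} := Fintype.ofFinite _
      have hc := h3 x i
      rw [← Nat.card_coe_set_eq, Nat.card_eq_fintype_card] at hc
      obtain ⟨e⟩ := Function.Embedding.nonempty_of_card_le
        (α := {v : V | P v = x ∧ lay v = i}) (β := Fin ℓ) (by simpa using hc)
      exact ⟨e, e.injective⟩
    choose g hg using key
    refine ⟨fun v => (P v, lay v, g (P v) (lay v) ⟨v, rfl, rfl⟩), ?_, fun u v e => ⟨?_, h1 u v e⟩⟩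
    · intro u v huv
      simp only [Prod.mk.injEq] at huv
      obtain ⟨a, b, c⟩ := huv
      have aux : ∀ (x : W) (i : ℕ) (hx : P u = x) (hi : lay u = i),
          g (P u) (lay u) ⟨u, rfl, rfl⟩ = g x i ⟨u, hx, hi⟩ := by
        rintro _ _ rfl rfl
        rfl
      rw [aux _ _ a b] at c
      exact congrArg Subtype.val (hg _ _ c)
    · by_cases hP : P u = P v
      · exact Or.inl hP
      · exact Or.inr (h2 u v e hP)
end

section
/- For every finite simple graph G, every simple graph H and every integer ℓ ≥ 1, the following are equivalent: (1) there is an injective map f : V(G) → V(H) × Fin ℓ × ℕ such that for every edge uv of G, writing f(u) = (x, s, i) and f(v) = (y, t, j), one has (x = y or xy ∈ E(H)) and |i − j| = 1 (i.e. G is isomorphic to a subgraph of the semi-strong product (H ⊠ K_ℓ) ⋈ P where P is the one-way infinite path on ℕ); (2) there exist a layering (L_0, L_1, …) of G in which every layer L_i is an independent set of G, and a partition 𝒫 of V(G) into nonempty parts such that the quotient G/𝒫 is isomorphic to a subgraph of H and |A ∩ L_i| ≤ ℓ for every part A ∈ 𝒫 and every layer L_i. -/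
/-- For a finite graph `G`, a graph `H` and `ℓ ≥ 1`:
`G` is isomorphic to a subgraph of the semi-strong product `(H ⊠ K_ℓ) ⋈ P`
(for the one-way infinite path `P` on `ℕ`)
iff `G` has a layering `lay` in which every layer is an independent set, and a partition
(encoded by `P : V → W`; its parts are the nonempty fibres of `P`, and the quotient maps
injectively into `H`, adjacency-preservingly) of width at most `ℓ`. -/
theorem stmt_1 {V W : Type} [Fintype V] (G : SimpleGraph V) (H : SimpleGraph W)
    (ℓ : ℕ) (hℓ : 1 ≤ ℓ) :
    (∃ f : V → W × Fin ℓ × ℕ, Function.Injective f ∧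
      ∀ u v : V, G.Adj u v →
        ((f u).1 = (f v).1 ∨ H.Adj (f u).1 (f v).1) ∧
        |((f u).2.2 : ℤ) - ((f v).2.2 : ℤ)| = 1) ↔
    (∃ (lay : V → ℕ) (P : V → W),
      (∀ u v : V, G.Adj u v → |((lay u : ℤ)) - ((lay v : ℤ))| ≤ 1) ∧
      (∀ u v : V, G.Adj u v → lay u ≠ lay v) ∧
      (∀ u v : V, G.Adj u v → P u ≠ P v → H.Adj (P u) (P v)) ∧
      (∀ (x : W) (i : ℕ), Set.ncard {v : V | P v = x ∧ lay v = i} ≤ ℓ)) := by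
  constructor
  · rintro ⟨f, hf, h⟩
    refine ⟨fun v => (f v).2.2, fun v => (f v).1, fun u v huv => (h u v huv).2.le, ?_, ?_, ?_⟩
    · intro u v huv he
      have h1 := (h u v huv).2
      simp only at he
      rw [he] at h1
      simp at h1
    · intro u v huv hne
      exact (h u v huv).1.resolve_left hne
    · intro x i
      have h1 := Set.ncard_le_ncard_of_injOn (s := {v : V | (f v).1 = x ∧ (f v).2.2 = i})
        (t := (Set.univ : Set (Fin ℓ))) (fun v => (f v).2.1) (fun _ _ => Set.mem_univ _)
        (by
          rintro u ⟨hu1, hu2⟩ v ⟨hv1, hv2⟩ huv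
          exact hf (Prod.ext (hu1.trans hv1.symm) (Prod.ext huv (hu2.trans hv2.symm))))
        Set.finite_univ
      simpa [Set.ncard_univ] using h1
  · rintro ⟨lay, P, h1, h2, h3, h4⟩
    have key : ∀ (x : W) (i : ℕ), ∃ g : V → Fin ℓ, Set.InjOn g {v : V | P v = x ∧ lay v = i} := by
      intro x i
      have : Nonempty (Fin ℓ) := ⟨⟨0, hℓ⟩⟩
      have hfin : {v : V | P v = x ∧ lay v = i}.Finite := Set.toFinite _
      obtain ⟨g, -, hg⟩ := hfin.exists_injOn_of_encard_le (t := (Set.univ : Set (Fin ℓ))) (by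
        rw [← hfin.cast_ncard_eq, ← Set.finite_univ.cast_ncard_eq]
        have h5 : (Set.univ : Set (Fin ℓ)).ncard = ℓ := by simp [Set.ncard_univ]
        rw [h5]
        exact_mod_cast h4 x i)
      exact ⟨g, hg⟩
    choose g hg using key
    refine ⟨fun v => (P v, g (P v) (lay v) v, lay v), ?_, ?_⟩
    · intro u v huv
      simp only [Prod.mk.injEq] at huv
      obtain ⟨hP, hgg, hl⟩ := huv
      rw [hP, hl] at hgg
      exact hg (P v) (lay v) ⟨hP, hl⟩ ⟨rfl, rfl⟩ hgg
    · intro u v huv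
      refine ⟨?_, ?_⟩
      · by_cases hP : P u = P v
        · exact Or.inl hP
        · exact Or.inr (h3 u v huv hP)
      · have ha := h1 u v huv
        have hb := h2 u v huv
        have hc : (lay u : ℤ) - (lay v : ℤ) ≠ 0 := by omega
        exact le_antisymm ha (Int.one_le_abs hc)
end

section
/- Let G be a finite simple graph with a layering (L_0, L_1, …, L_n), and for each i ∈ {1, …, n} let M_i be a matching in G all of whose edges have one endpoint in L_{i−1} and the other in L_i. Let J be the spanning subgraph of G whose edge set is the union of the M_i. Then every connected component of J is a path that is vertical with respect to the layering, i.e. it contains at most one vertex from each layer L_i. -/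
/-- If `G` is a finite graph with a layering `lay` (taking values in `{0, …, n}`),
`M i` (for `1 ≤ i ≤ n`) are matchings whose edges join `L_{i-1}` to `L_i`, and `J` is the
spanning subgraph whose edges are the union of the matchings, then every connected component
of `J` is a path that is vertical with respect to the layering (at most one vertex per layer). -/
theorem stmt_2 {V : Type} [Fintype V] (G : SimpleGraph V) (n : ℕ) (lay : V → ℕ)
    (hlay_le : ∀ v : V, lay v ≤ n)
    (hlay : ∀ u v : V, G.Adj u v → |((lay u : ℤ)) - ((lay v : ℤ))| ≤ 1)
    (M : ℕ → V → V → Prop)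
    (hM_sub : ∀ i, 1 ≤ i → i ≤ n → ∀ u v : V, M i u v → G.Adj u v)
    (hM_symm : ∀ i, 1 ≤ i → i ≤ n → ∀ u v : V, M i u v → M i v u)
    (hM_match : ∀ i, 1 ≤ i → i ≤ n → ∀ u v w : V, M i u v → M i u w → v = w)
    (hM_layer : ∀ i, 1 ≤ i → i ≤ n → ∀ u v : V, M i u v →
      (lay u = i - 1 ∧ lay v = i) ∨ (lay u = i ∧ lay v = i - 1))
    (J : SimpleGraph V)
    (hJ : ∀ u v : V, J.Adj u v ↔ ∃ i, 1 ≤ i ∧ i ≤ n ∧ M i u v) :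
    ∀ c : J.ConnectedComponent,
      (∃ m : ℕ, Nonempty ((J.induce c.supp) ≃g SimpleGraph.pathGraph m)) ∧
      (∀ u v : V, u ∈ c.supp → v ∈ c.supp → lay u = lay v → u = v) := by
  classical
  set R : V → V → Prop := fun a b => J.Adj a b ∧ lay b = lay a + 1 with hR
  have hstep : ∀ u v, J.Adj u v → lay v = lay u + 1 ∨ lay u = lay v + 1 := by
    intro u v h
    obtain ⟨i, h1, h2, h3⟩ := (hJ u v).1 h
    have := hM_layer i h1 h2 u v h3
    omega
  have huniq : ∀ u v w, J.Adj u v → J.Adj u w → lay v = lay w → v = w := by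
    intro u v w h h' e
    obtain ⟨i, h1, h2, h3⟩ := (hJ u v).1 h
    obtain ⟨j, g1, g2, g3⟩ := (hJ u w).1 h'
    have a := hM_layer i h1 h2 u v h3
    have b := hM_layer j g1 g2 u w g3
    have hij : i = j := by omega
    subst hij
    exact hM_match i h1 h2 u v w h3 g3
  have hmono : ∀ u v, Relation.ReflTransGen R u v → u = v ∨ lay u < lay v := by
    intro u v h
    induction h with
    | refl => left; rfl
    | tail _ h2 ih =>
      right
      have := h2.2
      rcases ih with rfl | ih <;> omega
  have hreach : ∀ u v, J.Reachable u v →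
      Relation.ReflTransGen R u v ∨ Relation.ReflTransGen R v u := by
    rintro u v ⟨p⟩
    induction p with
    | nil => left; exact .refl
    | @cons u w v h p ih =>
      rcases hstep _ _ h with e | e
      · have hr : R u w := ⟨h, e⟩
        rcases ih with ih | ih
        · exact Or.inl (.head hr ih)
        · rcases Relation.ReflTransGen.cases_tail ih with e' | ⟨x, hx, hxw⟩
          · subst e'; exact Or.inl (.single hr)
          · have : x = u := huniq w x u hxw.1.symm h.symm (by have := hxw.2; omega)
            subst this; exact Or.inr hx
      · have hr : R w u := ⟨h.symm, e⟩
        rcases ih with ih | ih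
        · rcases Relation.ReflTransGen.cases_head ih with e' | ⟨x, hxw, hx⟩
          · subst e'; exact Or.inr (.single hr)
          · have : x = u := huniq w x u hxw.1 h.symm (by have := hxw.2; omega)
            subst this; exact Or.inl hx
        · exact Or.inr (.tail ih hr)
  have hasc : ∀ u v, Relation.ReflTransGen R u v → J.Reachable u v := by
    intro u v h
    induction h with
    | refl => exact .refl _
    | tail _ h2 ih => exact ih.trans h2.1.reachable
  intro c
  have hcr : ∀ u v, u ∈ c.supp → v ∈ c.supp → J.Reachable u v := by
    intro u v hu hv
    rw [SimpleGraph.ConnectedComponent.mem_supp_iff] at hu hv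
    exact SimpleGraph.ConnectedComponent.exact (hu.trans hv.symm)
  have hcm : ∀ u v, u ∈ c.supp → J.Reachable u v → v ∈ c.supp := by
    intro u v hu h
    rw [SimpleGraph.ConnectedComponent.mem_supp_iff] at hu ⊢
    rw [← hu]
    exact (SimpleGraph.ConnectedComponent.sound h).symm
  have hinj : ∀ u v : V, u ∈ c.supp → v ∈ c.supp → lay u = lay v → u = v := by
    intro u v hu hv e
    rcases hreach u v (hcr u v hu hv) with h | h
    · rcases hmono _ _ h with h | h
      · exact h
      · omega
    · rcases hmono _ _ h with h | h
      · exact h.symm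
      · omega
  refine ⟨?_, hinj⟩
  have hne : c.supp.Nonempty := c.nonempty_supp
  obtain ⟨s, hs, hsmin⟩ := Set.exists_min_image c.supp lay (Set.toFinite _) hne
  obtain ⟨t, ht, htmax⟩ := Set.exists_max_image c.supp lay (Set.toFinite _) hne
  have hfrom : ∀ v ∈ c.supp, Relation.ReflTransGen R s v := by
    intro v hv
    rcases hreach s v (hcr s v hs hv) with h | h
    · exact h
    · rcases hmono _ _ h with e | e
      · rw [e]
      · have := hsmin v hv
        omega
  have hhit : ∀ v, Relation.ReflTransGen R s v → ∀ a, lay s ≤ a → a ≤ lay v →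
      ∃ w, Relation.ReflTransGen R s w ∧ lay w = a := by
    intro v h
    induction h with
    | refl => intro a h1 h2; exact ⟨s, .refl, by omega⟩
    | @tail x y h1 h2 ih =>
      intro a ha hb
      by_cases e : a = lay y
      · exact ⟨y, .tail h1 h2, e.symm⟩
      · exact ih a ha (by have := h2.2; omega)
  have hadj : ∀ v w, v ∈ c.supp → w ∈ c.supp → lay w = lay v + 1 → J.Adj v w := by
    intro v w hv hw e
    rcases Relation.ReflTransGen.cases_tail (hfrom w hw) with e' | ⟨x, hx, hxw⟩
    · subst e'
      have := hsmin v hv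
      omega
    · have : x = v := hinj x v (hcm s x hs (hasc _ _ hx)) hv (by have := hxw.2; omega)
      subst this; exact hxw.1
  let f : c.supp → Fin (lay t - lay s + 1) := fun v =>
    ⟨lay v.1 - lay s, by have := htmax v.1 v.2; omega⟩
  have hf : Function.Bijective f := by
    constructor
    · intro v w h
      have h' : lay v.1 - lay s = lay w.1 - lay s := congrArg Fin.val h
      have h1 := hsmin v.1 v.2
      have h2 := hsmin w.1 w.2
      exact Subtype.ext (hinj _ _ v.2 w.2 (by omega))
    · rintro ⟨k, hk⟩
      have := hsmin t ht
      obtain ⟨w, hw, e⟩ := hhit t (hfrom t ht) (lay s + k) (by omega) (by omega)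
      refine ⟨⟨w, hcm s w hs (hasc _ _ hw)⟩, Fin.ext ?_⟩
      change lay w - lay s = k
      omega
  refine ⟨lay t - lay s + 1, ⟨⟨Equiv.ofBijective f hf, ?_⟩⟩⟩
  rintro ⟨v, hv⟩ ⟨w, hw⟩
  rw [SimpleGraph.pathGraph_adj]
  change (lay v - lay s + 1 = lay w - lay s ∨ lay w - lay s + 1 = lay v - lay s) ↔ J.Adj v w
  have h1 := hsmin v hv
  have h2 := hsmin w hw
  constructor
  · rintro (h | h)
    · exact hadj v w hv hw (by omega)
    · exact (hadj w v hw hv (by omega)).symm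
  · intro h
    have := hstep v w h
    omega
end

section
/- Let G be a finite simple graph with a layering (L_0, L_1, …, L_n), and suppose that for each i ∈ {1, …, n} there is a matching M_i in G all of whose edges have one endpoint in L_{i−1} and the other in L_i. Then there exist a simple graph H that is a minor of G and an injective map f : V(G) → V(H) × ℕ such that for every edge uv of G, writing f(u) = (x, i) and f(v) = (y, j), one has (x = y or xy ∈ E(H)) and |i − j| ≤ 1. Moreover, if every layer L_i is an independent set of G, then f can be chosen so that additionally |i − j| = 1 for every edge uv of G (i.e. G is isomorphic to a subgraph of the semi-strong product H ⋈ P, where P is the one-way infinite path on ℕ). -/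
/-- A model of a graph `X` in a graph `G`: each vertex of `X` is represented by a nonempty
connected subgraph of `G`, distinct vertices get vertex-disjoint subgraphs, and adjacent
vertices of `X` get subgraphs joined by an edge of `G`. -/
def IsModelIn {V W : Type} (G : SimpleGraph V) (X : SimpleGraph W)
    (μ : W → G.Subgraph) : Prop :=
  (∀ u : W, (μ u).verts.Nonempty) ∧
  (∀ u : W, (μ u).Connected) ∧
  (∀ u v : W, u ≠ v → Disjoint (μ u).verts (μ v).verts) ∧
  (∀ u v : W, X.Adj u v → ∃ a ∈ (μ u).verts, ∃ b ∈ (μ v).verts, G.Adj a b)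

/-- Let `G` be a finite graph with a layering `lay` (with values in `{0, …, n}`)
such that for each `i ∈ {1, …, n}` there is a matching `M i` all of whose edges join
layer `i-1` to layer `i`. Then there is a graph `H` that is a minor of `G` such that
`G` is isomorphic to a subgraph of `H ⊠ P` (for the one-way infinite path `P` on `ℕ`);
moreover, if every layer is an independent set, `G` is isomorphic to a subgraph of the
semi-strong product `H ⋈ P`. -/
theorem stmt_3 {V : Type} [Fintype V] (G : SimpleGraph V) (n : ℕ) (lay : V → ℕ)
    (hlay_le : ∀ v : V, lay v ≤ n)
    (hlay : ∀ u v : V, G.Adj u v → |((lay u : ℤ)) - ((lay v : ℤ))| ≤ 1)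
    (M : ℕ → V → V → Prop)
    (hM_sub : ∀ i, 1 ≤ i → i ≤ n → ∀ u v : V, M i u v → G.Adj u v)
    (hM_symm : ∀ i, 1 ≤ i → i ≤ n → ∀ u v : V, M i u v → M i v u)
    (hM_match : ∀ i, 1 ≤ i → i ≤ n → ∀ u v w : V, M i u v → M i u w → v = w)
    (hM_layer : ∀ i, 1 ≤ i → i ≤ n → ∀ u v : V, M i u v →
      (lay u = i - 1 ∧ lay v = i) ∨ (lay u = i ∧ lay v = i - 1)) :
    ∃ (W : Type) (H : SimpleGraph W),
      (∃ μ : W → G.Subgraph, IsModelIn G H μ) ∧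
      (∃ f : V → W × ℕ, Function.Injective f ∧
        ∀ u v : V, G.Adj u v →
          ((f u).1 = (f v).1 ∨ H.Adj (f u).1 (f v).1) ∧
          |((f u).2 : ℤ) - ((f v).2 : ℤ)| ≤ 1) ∧
      ((∀ u v : V, G.Adj u v → lay u ≠ lay v) →
        ∃ f : V → W × ℕ, Function.Injective f ∧
          ∀ u v : V, G.Adj u v →
            ((f u).1 = (f v).1 ∨ H.Adj (f u).1 (f v).1) ∧
            |((f u).2 : ℤ) - ((f v).2 : ℤ)| = 1) := by
  classical
  set U : V → V → Prop := fun u v => lay v = lay u + 1 ∧ lay v ≤ n ∧ M (lay v) u v with hU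
  have U_right : ∀ a b c, U a b → U a c → b = c := by
    rintro a b c ⟨h1, h2, h3⟩ ⟨h4, h5, h6⟩
    have : lay c = lay b := by omega
    rw [this] at h6
    exact hM_match (lay b) (by omega) h2 a b c h3 h6
  have U_left : ∀ a b c, U a c → U b c → a = b := by
    rintro a b c ⟨h1, h2, h3⟩ ⟨h4, h5, h6⟩
    exact hM_match (lay c) (by omega) h2 c a b (hM_symm _ (by omega) h2 _ _ h3)
      (hM_symm _ (by omega) h2 _ _ h6)
  have U_adj : ∀ a b, U a b → G.Adj a b := by
    rintro a b ⟨h1, h2, h3⟩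
    exact hM_sub (lay b) (by omega) h2 a b h3
  let F : SimpleGraph V :=
    { Adj := fun u v => U u v ∨ U v u
      symm := ⟨fun u v h => h.symm⟩
      loopless := ⟨fun u h => by rcases h with h | h <;> exact absurd h.1 (by omega)⟩ }
  have hFG : F ≤ G := by
    intro a b h
    rcases h with h | h
    · exact U_adj _ _ h
    · exact (U_adj _ _ h).symm
  have key : ∀ u v, F.Reachable u v →
      Relation.ReflTransGen U u v ∨ Relation.ReflTransGen U v u := by
    intro u v h
    rw [SimpleGraph.reachable_iff_reflTransGen] at h
    induction h with
    | refl => exact Or.inl .refl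
    | @tail v w _ hvw ih =>
      rcases hvw with hvw | hvw
      · rcases ih with ih | ih
        · exact Or.inl (ih.tail hvw)
        · rcases ih.cases_head with rfl | ⟨x, hx, hxu⟩
          · exact Or.inl (.single hvw)
          · rw [U_right _ _ _ hvw hx]; exact Or.inr hxu
      · rcases ih with ih | ih
        · rcases ih.cases_tail with rfl | ⟨x, hxu, hx⟩
          · exact Or.inr (.single hvw)
          · rw [U_left _ _ _ hvw hx]; exact Or.inl hxu
        · exact Or.inr (ih.head hvw)
  have mono : ∀ u v, Relation.ReflTransGen U u v → u = v ∨ lay u < lay v := by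
    intro u v h
    induction h with
    | refl => exact Or.inl rfl
    | tail _ h ih =>
      have := h.1
      rcases ih with rfl | ih
      · right; omega
      · right; omega
  let H : SimpleGraph F.ConnectedComponent :=
    { Adj := fun x y => x ≠ y ∧ ∃ a ∈ x.supp, ∃ b ∈ y.supp, G.Adj a b
      symm := ⟨fun x y ⟨h, a, ha, b, hb, hab⟩ => ⟨h.symm, b, hb, a, ha, hab.symm⟩⟩
      loopless := ⟨fun x h => h.1 rfl⟩ }
  have hinj : Function.Injective (fun v : V => (F.connectedComponentMk v, lay v)) := by
    intro u v h
    simp only [Prod.mk.injEq] at h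
    obtain ⟨h1, h2⟩ := h
    rcases key u v (SimpleGraph.ConnectedComponent.exact h1) with h | h
    · rcases mono _ _ h with h | h
      · exact h
      · omega
    · rcases mono _ _ h with h | h
      · exact h.symm
      · omega
  have hH : ∀ u v : V, G.Adj u v → F.connectedComponentMk u = F.connectedComponentMk v ∨
      H.Adj (F.connectedComponentMk u) (F.connectedComponentMk v) := by
    intro u v h
    by_cases he : F.connectedComponentMk u = F.connectedComponentMk v
    · exact Or.inl he
    · exact Or.inr ⟨he, u, rfl, v, rfl, h⟩
  refine ⟨F.ConnectedComponent, H,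
    ⟨fun c => (⊤ : G.Subgraph).induce c.supp, ?_, ?_, ?_, ?_⟩,
    ⟨_, hinj, fun u v h => ⟨hH u v h, hlay u v h⟩⟩,
    fun hind => ⟨_, hinj, fun u v h => ⟨hH u v h, ?_⟩⟩⟩
  · intro c
    exact c.nonempty_supp
  · intro c
    rw [← SimpleGraph.connected_induce_iff]
    exact c.connected_toSimpleGraph.mono (fun a b h => hFG h)
  · intro c d hcd
    exact SimpleGraph.pairwise_disjoint_supp_connectedComponent F hcd
  · rintro c d ⟨_, h⟩
    exact h
  · have h1 := hlay u v h
    have h2 := hind u v h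
    rw [abs_le] at h1
    rw [abs_eq (by norm_num)]
    dsimp only
    omega
end

section
/- Let G be a finite bipartite simple graph with bipartition classes A and B, each equipped with a linear order, and suppose the edges of G are non-crossing, meaning there do not exist edges ab and a'b' of G with a, a' ∈ A, b, b' ∈ B, a < a' and b' < b. Let S ⊆ A be a set of vertices each of which has at least two neighbours in B. Then the set of edges { a·m(a) : a ∈ S }, where m(a) denotes the minimum (leftmost) neighbour of a in B, is a matching in G that saturates S, i.e. every vertex of S is an endpoint of exactly one of these edges and no two of these edges share an endpoint. -/
/-- Let `G` be a finite bipartite graph with bipartition classes `A` (encoded as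
`Sum.inl` over the linearly ordered type `α`) and `B` (encoded as `Sum.inr` over the linearly
ordered type `β`), all of whose edges join `A` to `B`, and whose edges are non-crossing.
Let `S ⊆ A` consist of vertices with at least two neighbours in `B`, and for `a ∈ S`
let `m a` be the minimum neighbour of `a` in `B`. Then the set of edges `{a·(m a) : a ∈ S}`
is a matching in `G` saturating `S`: every `a ∈ S` is matched along the edge `a·(m a)` of `G`,
and no two of these edges share an endpoint. -/
theorem stmt_4 {α β : Type} [Fintype α] [Fintype β] [LinearOrder α] [LinearOrder β]
    (G : SimpleGraph (α ⊕ β))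
    (hbip : ∀ u v : α ⊕ β, G.Adj u v →
      (∃ (a : α) (b : β), u = Sum.inl a ∧ v = Sum.inr b) ∨
      (∃ (b : β) (a : α), u = Sum.inr b ∧ v = Sum.inl a))
    (hnc : ¬ ∃ (a a' : α) (b b' : β),
      G.Adj (Sum.inl a) (Sum.inr b) ∧ G.Adj (Sum.inl a') (Sum.inr b') ∧ a < a' ∧ b' < b)
    (S : Set α)
    (hS : ∀ a ∈ S, ∃ b b' : β, b ≠ b' ∧ G.Adj (Sum.inl a) (Sum.inr b) ∧
      G.Adj (Sum.inl a) (Sum.inr b'))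
    (m : α → β)
    (hm_adj : ∀ a ∈ S, G.Adj (Sum.inl a) (Sum.inr (m a)))
    (hm_min : ∀ a ∈ S, ∀ b : β, G.Adj (Sum.inl a) (Sum.inr b) → m a ≤ b) :
    (∀ a ∈ S, G.Adj (Sum.inl a) (Sum.inr (m a))) ∧
    (∀ a ∈ S, ∀ a' ∈ S, a ≠ a' → m a ≠ m a') := by
  have key : ∀ a ∈ S, ∀ a' ∈ S, a < a' → m a ≠ m a' := by
    intro a ha a' ha' hlt heq
    obtain ⟨b, b', hne, hb, hb'⟩ := hS a ha
    have h1 := hm_min a ha b hb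
    have h2 := hm_min a ha b' hb'
    have hex : ∃ c, G.Adj (Sum.inl a) (Sum.inr c) ∧ m a < c := by
      rcases h1.lt_or_eq with h | h
      · exact ⟨b, hb, h⟩
      · exact ⟨b', hb', lt_of_le_of_ne h2 (fun h3 => hne (h.symm.trans h3))⟩
    obtain ⟨c, hc, hlc⟩ := hex
    exact hnc ⟨a, a', c, m a', hc, hm_adj a' ha', hlt, heq ▸ hlc⟩
  refine ⟨hm_adj, fun a ha a' ha' hne => ?_⟩
  rcases lt_or_gt_of_ne hne with h | h
  · exact key a ha a' ha' h
  · exact (key a' ha' a ha h).symm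
end

section
/- For all positive integers a and n there exists a positive integer n' with the following property: for every finite simple graph G, every simple graph H, every H-partition (A_x : x ∈ V(H)) of G with |A_x| ≤ a for all x ∈ V(H), and every w ∈ V(H), if G contains a path on n' vertices, then the induced subgraph of H on V(H) \ {w} contains a path on n vertices. -/
/-- `G` contains a path on `n` vertices: `n` distinct vertices with consecutive ones adjacent. -/
def HasPathOn {α : Type*} (G : SimpleGraph α) (n : ℕ) : Prop :=
  ∃ p : ℕ → α, (∀ i < n, ∀ j < n, p i = p j → i = j) ∧
    (∀ i : ℕ, i + 1 < n → G.Adj (p i) (p (i + 1)))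

open Finset in
theorem gap_aux (a M N : ℕ) (S : Finset ℕ) (h0 : 0 ∈ S) (hS : S.card ≤ a)
    (hN : a * (M + 1) + 1 ≤ N) :
    ∃ i ∈ S, i + M < N ∧ ∀ j < M, i + 1 + j ∉ S := by
  by_contra hcon
  push Not at hcon
  have hcov : range N ⊆ S.biUnion (fun i => Finset.Icc i (i + M)) := by
    intro j hj
    have hj' : j < N := Finset.mem_range.1 hj
    have hne : (S.filter (· ≤ j)).Nonempty := ⟨0, by simp [h0]⟩
    obtain ⟨i, hi, hmax⟩ := Finset.exists_max_image (S.filter (· ≤ j)) id hne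
    rw [Finset.mem_filter] at hi
    rw [Finset.mem_biUnion]
    refine ⟨i, hi.1, ?_⟩
    rw [Finset.mem_Icc]
    refine ⟨hi.2, ?_⟩
    by_contra hlt
    obtain ⟨k, hk, hkS⟩ := hcon i hi.1 (by omega)
    have := hmax (i + 1 + k) (by rw [Finset.mem_filter]; exact ⟨hkS, by omega⟩)
    simp only [id] at this
    omega
  have h1 := Finset.card_le_card hcov
  have h2 : (S.biUnion (fun i => Finset.Icc i (i + M))).card ≤ S.card * (M + 1) := by
    apply Finset.card_biUnion_le_card_mul
    intro i _
    rw [Nat.card_Icc]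
    omega
  have h3 : S.card * (M + 1) ≤ a * (M + 1) := Nat.mul_le_mul_right _ hS
  rw [Finset.card_range] at h1
  omega

open Classical in
theorem core_aux (a k : ℕ) : ∃ N : ℕ, 1 ≤ N ∧ ∀ (W : Type) (H : SimpleGraph W) (f : ℕ → W),
    (∀ i, i + 1 < N → f i = f (i + 1) ∨ H.Adj (f i) (f (i + 1))) →
    (∀ x, ((Finset.range N).filter (fun i => f i = x)).card ≤ a) →
    ∃ p : ℕ → W, p 0 = f 0 ∧ (∀ i < k + 1, ∀ j < k + 1, p i = p j → i = j) ∧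
      (∀ i, i + 1 < k + 1 → H.Adj (p i) (p (i + 1))) ∧
      (∀ i < k + 1, ∃ j < N, p i = f j) := by
  induction k with
  | zero =>
    refine ⟨1, le_rfl, fun W H f _ _ => ⟨fun _ => f 0, rfl, ?_, ?_, ?_⟩⟩
    · intros; omega
    · intros; omega
    · intros; exact ⟨0, by omega, rfl⟩
  | succ k ih =>
    obtain ⟨M, hM, ih⟩ := ih
    refine ⟨a * (M + 1) + 1, by omega, fun W H f hf hc => ?_⟩
    obtain ⟨i, hiS, hiN, hgap⟩ := gap_aux a M (a * (M + 1) + 1)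
      ((Finset.range (a * (M + 1) + 1)).filter (fun i => f i = f 0)) (by simp) (hc _) le_rfl
    have hgap' : ∀ j < M, f (i + 1 + j) ≠ f 0 := by
      intro j hj he
      apply hgap j hj
      rw [Finset.mem_filter, Finset.mem_range]
      exact ⟨by omega, he⟩
    rw [Finset.mem_filter] at hiS
    obtain ⟨p, hp0, hinj, hadj, him⟩ := ih W H (fun j => f (i + 1 + j))
      (fun j hj => hf (i + 1 + j) (by omega)) (by
        intro x
        refine le_trans ?_ (hc x)
        apply Finset.card_le_card_of_injOn (fun j => i + 1 + j)
        · intro j hj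
          simp only [Finset.coe_filter, Finset.mem_range, Set.mem_ofPred_eq] at hj ⊢
          exact ⟨by omega, hj.2⟩
        · intro j _ l _ h
          simp only at h
          omega)
    have hpx : ∀ j < k + 1, p j ≠ f 0 := by
      intro j hj
      obtain ⟨l, hl, he⟩ := him j hj
      rw [he]
      exact hgap' l hl
    refine ⟨fun j => if j = 0 then f 0 else p (j - 1), by simp, ?_, ?_, ?_⟩
    · intro u hu v hv h
      rcases u with _ | u <;> rcases v with _ | v
      · rfl
      · exact absurd (by simpa using h.symm) (hpx v (by omega))
      · exact absurd (by simpa using h) (hpx u (by omega))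
      · have := hinj u (by omega) v (by omega) (by simpa using h)
        omega
    · intro u hu
      rcases u with _ | u
      · have h1 : f (i + 1) ≠ f 0 := hgap' 0 (by omega)
        rcases hf i (by omega) with h | h
        · exact absurd (h.symm.trans hiS.2) h1
        · rw [hiS.2] at h
          simpa [hp0] using h
      · simpa using hadj u (by omega)
    · intro u hu
      rcases u with _ | u
      · exact ⟨0, by omega, by simp⟩
      · obtain ⟨l, hl, he⟩ := him u (by omega)
        exact ⟨i + 1 + l, by omega, by simpa using he⟩

/-- For all `a, n ≥ 1` there is `n'` such that for every finite graph `G`,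
every `H`-partition of `G` (encoded by a surjection `P : V → W` whose nonempty fibres are the
parts, with `H`-adjacency matching the existence of cross edges) with all parts of size at
most `a`, and every `w ∈ V(H)`: if `G` contains a path on `n'` vertices, then `H - w`
contains a path on `n` vertices. -/
theorem stmt_5 (a n : ℕ) (ha : 1 ≤ a) (hn : 1 ≤ n) :
    ∃ n' : ℕ, 1 ≤ n' ∧
      ∀ (V W : Type) (_ : Fintype V) (G : SimpleGraph V) (H : SimpleGraph W) (P : V → W),
        Function.Surjective P →
        (∀ x y : W, x ≠ y →
          (H.Adj x y ↔ ∃ u v : V, P u = x ∧ P v = y ∧ G.Adj u v)) →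
        (∀ x : W, Set.ncard {v : V | P v = x} ≤ a) →
        ∀ w : W, HasPathOn G n' → HasPathOn (H.induce {x : W | x ≠ w}) n := by
  classical
  obtain ⟨k, rfl⟩ : ∃ k, n = k + 1 := ⟨n - 1, by omega⟩
  obtain ⟨M, hM, core⟩ := core_aux a k
  refine ⟨(a + 1) * (M + 1) + 1, by omega, ?_⟩
  rintro V W _ G H P - hH hcard w ⟨q, hqinj, hqadj⟩
  generalize hNdef : (a + 1) * (M + 1) + 1 = N at *
  have hc : ∀ x, ((Finset.range N).filter (fun i => P (q i) = x)).card ≤ a := by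
    intro x
    refine le_trans ?_ (hcard x)
    rw [← Set.ncard_coe_finset]
    apply Set.ncard_le_ncard_of_injOn q
    · intro i hi
      simp only [Finset.coe_filter, Finset.mem_range, Set.mem_ofPred_eq] at hi ⊢
      exact hi.2
    · intro i hi j hj h
      simp only [Finset.coe_filter, Finset.mem_range, Set.mem_ofPred_eq] at hi hj
      exact hqinj i hi.1 j hj.1 h
  obtain ⟨i, -, hiN, hgap⟩ := gap_aux (a + 1) M N
    (insert 0 ((Finset.range N).filter (fun i => P (q i) = w))) (by simp)
    (le_trans (Finset.card_insert_le _ _) (by have := hc w; omega)) hNdef.le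
  have hgap' : ∀ j < M, P (q (i + 1 + j)) ≠ w := by
    intro j hj he
    apply hgap j hj
    rw [Finset.mem_insert, Finset.mem_filter, Finset.mem_range]
    exact Or.inr ⟨by omega, he⟩
  obtain ⟨p, -, hinj, hadj, him⟩ := core W H (fun j => P (q (i + 1 + j)))
    (by
      intro j hj
      by_cases h : P (q (i + 1 + j)) = P (q (i + 1 + (j + 1)))
      · exact Or.inl h
      · exact Or.inr ((hH _ _ h).2 ⟨_, _, rfl, rfl, hqadj (i + 1 + j) (by omega)⟩))
    (by
      intro x
      refine le_trans ?_ (hc x)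
      apply Finset.card_le_card_of_injOn (fun j => i + 1 + j)
      · intro j hj
        simp only [Finset.coe_filter, Finset.mem_range, Set.mem_ofPred_eq] at hj ⊢
        exact ⟨by omega, hj.2⟩
      · intro j _ l _ h
        simp only at h
        omega)
  have hpw : ∀ j, p (min j k) ≠ w := by
    intro j
    obtain ⟨l, hl, he⟩ := him (min j k) (by omega)
    rw [he]
    exact hgap' l hl
  refine ⟨fun j => ⟨p (min j k), hpw j⟩, ?_, ?_⟩
  · intro u hu v hv h
    have h' : p (min u k) = p (min v k) := congrArg Subtype.val h
    rw [min_eq_left (by omega), min_eq_left (by omega)] at h'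
    exact hinj u hu v hv h'
  · intro u hu
    have h := hadj u hu
    rw [SimpleGraph.induce_adj]
    simp only
    rw [min_eq_left (by omega), min_eq_left (by omega)]
    exact h
end

section
/- For all positive integers k, ℓ and n there exists a finite simple graph G with pathwidth at most k + 1 such that for every simple graph H: if there is an injective map f : V(G) → V(H) × ℕ × Fin ℓ such that for every edge uv of G, writing f(u) = (x, i, s) and f(v) = (y, j, t), one has (x = y or xy ∈ E(H)) and |i − j| ≤ 1 (i.e. G is isomorphic to a subgraph of H ⊠ P ⊠ K_ℓ for the one-way infinite path P on ℕ), then H contains a subgraph isomorphic to the complete join P_n + K_k. -/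
/-- The complete join `A + B` of graphs `A` and `B`: their disjoint union together with all
edges between them. -/
def completeJoin {α β : Type*} (A : SimpleGraph α) (B : SimpleGraph β) :
    SimpleGraph (α ⊕ β) :=
  SimpleGraph.fromRel (fun u v =>
    (∃ a b, u = Sum.inl a ∧ v = Sum.inl b ∧ A.Adj a b) ∨
    (∃ a b, u = Sum.inr a ∧ v = Sum.inr b ∧ B.Adj a b) ∨
    (u.isLeft = true ∧ v.isRight = true))

/-- `G` admits a path-decomposition of width at most `w`: a finite sequence of bags covering
all vertices, containing both endpoints of each edge in a common bag, such that the bags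
containing any fixed vertex form an interval, with all bags of size at most `w + 1`. -/
def HasPathDecompWidthLE {α : Type*} (G : SimpleGraph α) (w : ℕ) : Prop :=
  ∃ (m : ℕ) (B : Fin m → Finset α),
    (∀ v : α, ∃ i, v ∈ B i) ∧
    (∀ u v : α, G.Adj u v → ∃ i, u ∈ B i ∧ v ∈ B i) ∧
    (∀ (v : α) (i j k : Fin m), i ≤ j → j ≤ k → v ∈ B i → v ∈ B k → v ∈ B j) ∧
    (∀ i, (B i).card ≤ w + 1)

/-- Fibres of `f` have size at most `q`. -/
def FibLE {V W : Type} (f : V → W) (q : ℕ) : Prop :=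
  ∀ (x : W) (s : Finset V), (∀ v ∈ s, f v = x) → s.card ≤ q

/-- weak homomorphism -/
def WHom {V W : Type} (G : SimpleGraph V) (H : SimpleGraph W) (f : V → W) : Prop :=
  ∀ u v, G.Adj u v → f u = f v ∨ H.Adj (f u) (f v)

/-- Every weak homomorphism with small fibres yields a join of a path and a clique. -/
def Forces {V : Type} (G : SimpleGraph V) (q n k : ℕ) : Prop :=
  ∀ (W : Type) (H : SimpleGraph W) (f : V → W), FibLE f q → WHom G H f →
    ∃ l c : List W, l.length = n ∧ c.length = k ∧ l.Nodup ∧ l.IsChain H.Adj ∧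
      c.Pairwise H.Adj ∧ (∀ x ∈ l, ∀ y ∈ c, H.Adj x y) ∧
      (∀ x ∈ l, ∃ v, f v = x) ∧ (∀ x ∈ c, ∃ v, f v = x)

/-- Length of walk needed. -/
def walkLen (q : ℕ) : ℕ → ℕ
  | 0 => 1
  | n + 1 => 1 + (q + 1) * walkLen q n

lemma walkLen_pos (q n : ℕ) : 1 ≤ walkLen q n := by
  cases n <;> simp [walkLen]

lemma walk_path {W : Type} (H : SimpleGraph W) (q : ℕ) (f : ℕ → W) (n : ℕ) :
    ∀ a b : ℕ, a + walkLen q n ≤ b →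
    (∀ (x : W) (s : Finset ℕ), (∀ t ∈ s, a ≤ t ∧ t < b ∧ f t = x) → s.card ≤ q) →
    (∀ t, a ≤ t → t + 1 < b → f t = f (t + 1) ∨ H.Adj (f t) (f (t + 1))) →
    ∃ l : List W, (f a :: l).length = n + 1 ∧ (f a :: l).Nodup ∧ (f a :: l).IsChain H.Adj ∧
      ∀ x ∈ f a :: l, ∃ t, a ≤ t ∧ t < b ∧ f t = x := by
  induction n with
  | zero =>
    intro a b hab _ _
    refine ⟨[], by simp, by simp, by simp, ?_⟩
    intro x hx
    simp only [List.mem_singleton] at hx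
    simp only [walkLen] at hab
    exact ⟨a, le_rfl, by omega, hx.symm⟩
  | succ n ih =>
    intro a b hab hfib hstep
    set N := walkLen q n with hN
    have hN1 : 1 ≤ N := walkLen_pos q n
    have hab' : a + (1 + (q + 1) * N) ≤ b := hab
    -- a window free of `f a`
    have hwin : ∃ j, j < q + 1 ∧ ∀ t, a + 1 + j * N ≤ t → t < a + 1 + (j + 1) * N → f t ≠ f a := by
      by_contra hcon
      push Not at hcon
      choose! τ h1 h2 h3 using hcon
      have hinj : Set.InjOn τ (Finset.range (q + 1)) := by
        intro i hi j hj hij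
        simp only [Finset.coe_range, Set.mem_Iio] at hi hj
        have hi1 := h1 i hi
        have hi2 := h2 i hi
        have hj1 := h1 j hj
        have hj2 := h2 j hj
        rcases lt_trichotomy i j with h | h | h
        · have := Nat.mul_le_mul_right N (show i + 1 ≤ j from h)
          omega
        · exact h
        · have := Nat.mul_le_mul_right N (show j + 1 ≤ i from h)
          omega
      have := hfib (f a) ((Finset.range (q + 1)).image τ) (by
        intro t ht
        simp only [Finset.mem_image, Finset.mem_range] at ht
        obtain ⟨i, hi, rfl⟩ := ht
        have hi1 := h1 i hi
        have hi2 := h2 i hi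
        have := Nat.mul_le_mul_right N (show i + 1 ≤ q + 1 from hi)
        exact ⟨by omega, by omega, h3 i hi⟩)
      rw [Finset.card_image_of_injOn hinj] at this
      simp at this
    obtain ⟨j, hj, hfree⟩ := hwin
    classical
    set s := (Finset.Ico a (a + 1 + j * N)).filter (fun t => f t = f a) with hs
    have hne : s.Nonempty := ⟨a, by simp [hs]; omega⟩
    have hmax := s.max'_mem hne
    set t := s.max' hne with ht
    have hmem : a ≤ t ∧ t < a + 1 + j * N ∧ f t = f a := by
      have := hmax
      rw [hs] at this
      simp only [Finset.mem_filter, Finset.mem_Ico] at this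
      tauto
    set e := a + 1 + (j + 1) * N with he
    have hjN : (j + 1) * N = j * N + N := by ring
    have heb : e ≤ b := by
      have := Nat.mul_le_mul_right N (show j + 1 ≤ q + 1 from hj)
      omega
    have hfree' : ∀ u, t + 1 ≤ u → u < e → f u ≠ f a := by
      intro u hu1 hu2 hu3
      by_cases h : u < a + 1 + j * N
      · have : u ∈ s := by
          rw [hs]; simp only [Finset.mem_filter, Finset.mem_Ico]
          exact ⟨⟨by omega, h⟩, hu3⟩
        have := s.le_max' u this
        omega
      · exact hfree u (by omega) hu2 hu3
    obtain ⟨l, hl1, hl2, hl3, hl4⟩ := ih (t + 1) e (by omega)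
      (fun x s hs => hfib x s fun u hu => by
        have := hs u hu
        exact ⟨by omega, by omega, this.2.2⟩)
      (fun u h1 h2 => hstep u (by omega) (by omega))
    refine ⟨f (t + 1) :: l, by simpa using hl1, ?_, ?_, ?_⟩
    · rw [List.nodup_cons]
      refine ⟨fun hm => ?_, hl2⟩
      obtain ⟨u, hu1, hu2, hu3⟩ := hl4 _ hm
      exact hfree' u hu1 hu2 hu3
    · rw [List.isChain_cons_cons]
      refine ⟨?_, hl3⟩
      have h1 := hstep t hmem.1 (by omega)
      have h2 := hfree' (t + 1) le_rfl (by omega)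
      rw [hmem.2.2] at h1
      rcases h1 with h1 | h1
      · exact absurd h1.symm h2
      · exact h1
    · intro x hx
      rcases List.mem_cons.1 hx with rfl | hx
      · exact ⟨a, le_rfl, by omega, rfl⟩
      · obtain ⟨u, hu1, hu2, hu3⟩ := hl4 _ hx
        exact ⟨u, by omega, by omega, hu3⟩

lemma path_forces (q m : ℕ) :
    Forces (SimpleGraph.pathGraph (walkLen q m)) q (m + 1) 0 := by
  have hpos : 0 < walkLen q m := walkLen_pos q m
  obtain ⟨N, hN⟩ : ∃ N, N = walkLen q m := ⟨_, rfl⟩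
  rw [← hN] at hpos ⊢
  intro W H f hfib hhom
  let F : ℕ → W := fun t => if h : t < N then f ⟨t, h⟩ else f ⟨0, hpos⟩
  have hF : ∀ t (h : t < N), F t = f ⟨t, h⟩ := fun t h => by simp [F, h]
  obtain ⟨l, h1, h2, h3, h4⟩ := walk_path H q F m 0 N (by omega)
    (by
      intro x s hs
      have := hfib x (Finset.univ.filter (fun i : Fin N => (i : ℕ) ∈ s)) (by
        intro v hv
        simp only [Finset.mem_filter, Finset.mem_univ, true_and] at hv
        have := (hs _ hv).2.2
        rwa [hF _ v.2] at this)
      refine le_trans (le_of_eq ?_) this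
      symm
      refine Finset.card_bij (fun i _ => (i : ℕ)) ?_ ?_ ?_
      · intro i hi; simpa using hi
      · intro i _ j _ h; exact Fin.ext h
      · intro t ht
        exact ⟨⟨t, (hs t ht).2.1⟩, by simpa using ht, rfl⟩)
    (by
      intro t _ ht
      rw [hF t (by omega), hF (t + 1) ht]
      apply hhom
      rw [SimpleGraph.pathGraph_adj]
      simp)
  refine ⟨_, [], h1, rfl, h2, h3, by simp, by simp, ?_, by simp⟩
  intro x hx
  obtain ⟨t, _, ht, h⟩ := h4 x hx
  exact ⟨⟨t, ht⟩, by rw [← h, hF t ht]⟩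

lemma path_pd (N : ℕ) : HasPathDecompWidthLE (SimpleGraph.pathGraph N) 1 := by
  classical
  refine ⟨N, fun i => Finset.univ.filter (fun v => (v : ℕ) = i ∨ (v : ℕ) = i + 1), ?_, ?_, ?_, ?_⟩
  · intro v; exact ⟨v, by simp⟩
  · intro u v h
    rw [SimpleGraph.pathGraph_adj] at h
    rcases h with h | h
    · exact ⟨u, by simp, by simp [h]⟩
    · exact ⟨v, by simp [h], by simp⟩
  · intro v i j k hij hjk hi hk
    simp only [Finset.mem_filter, Finset.mem_univ, true_and, Fin.le_def] at *
    omega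
  · intro i
    refine le_trans (le_of_eq (Finset.card_image_of_injective _ Fin.val_injective).symm) ?_
    refine le_trans (Finset.card_le_card (t := {(i : ℕ), (i : ℕ) + 1}) ?_) Finset.card_le_two
    intro x hx
    simp only [Finset.mem_image, Finset.mem_filter, Finset.mem_univ, true_and] at hx
    obtain ⟨v, h, rfl⟩ := hx
    simpa using h

/-- Cone over `M` copies of `G`. -/
def cone {V : Type} (G : SimpleGraph V) (M : ℕ) : SimpleGraph (Option (Fin M × V)) where
  Adj x y := match x, y with
    | none, none => False
    | none, some _ => True
    | some _, none => True
    | some p, some r => p.1 = r.1 ∧ G.Adj p.2 r.2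
  symm := ⟨by
    rintro (_ | p) (_ | r) h
    · exact h
    · trivial
    · trivial
    · exact ⟨h.1.symm, h.2.symm⟩⟩
  loopless := ⟨by
    rintro (_ | p) h
    · exact h
    · exact G.loopless.irrefl _ h.2⟩

lemma cone_pd {V : Type} (G : SimpleGraph V) (M w : ℕ) (h : HasPathDecompWidthLE G w) :
    HasPathDecompWidthLE (cone G (M + 1)) (w + 1) := by
  classical
  obtain ⟨m, B, h1, h2, h3, h4⟩ := h
  by_cases hm : m = 0
  · subst hm
    have : IsEmpty V := ⟨fun v => (h1 v).choose.elim0⟩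
    refine ⟨1, fun _ => {none}, ?_, ?_, ?_, ?_⟩
    · rintro (_ | p)
      · exact ⟨0, by simp⟩
      · exact isEmptyElim p.2
    · rintro (_ | p) (_ | r) h
      · exact h.elim
      · exact isEmptyElim r.2
      · exact isEmptyElim p.2
      · exact isEmptyElim p.2
    · intro v i j k _ _ hi _; exact hi
    · simp
  have hm' : 0 < m := by omega
  have idx : ∀ (a : Fin (M + 1)) (i : Fin m), ∃ t : Fin ((M + 1) * m), t.divNat = a ∧ t.modNat = i :=
    fun a i => ⟨finProdFinEquiv (a, i), by
      have := finProdFinEquiv.symm_apply_apply (a, i)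
      simp only [finProdFinEquiv_symm_apply, Prod.mk.injEq] at this
      exact this⟩
  let C : Fin ((M + 1) * m) → Finset (Option (Fin (M + 1) × V)) := fun t =>
    insert none ((B t.modNat).image fun v => some (t.divNat, v))
  have hnone : ∀ t, none ∈ C t := fun t => by simp [C]
  have hsome : ∀ t p, some p ∈ C t ↔ t.divNat = p.1 ∧ p.2 ∈ B t.modNat := by
    rintro t ⟨a, v⟩
    simp only [C, Finset.mem_insert, Finset.mem_image, Option.some.injEq, Prod.mk.injEq,
      reduceCtorEq, false_or]
    constructor
    · rintro ⟨v', h, h', rfl⟩; exact ⟨h', h⟩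
    · rintro ⟨h, h'⟩; exact ⟨v, h', h, rfl⟩
  have hcov : ∀ p, ∃ t, some p ∈ C t := by
    intro p
    obtain ⟨i, hi⟩ := h1 p.2
    obtain ⟨t, ht, ht'⟩ := idx p.1 i
    exact ⟨t, (hsome t p).2 ⟨ht, ht' ▸ hi⟩⟩
  refine ⟨(M + 1) * m, C, ?_, ?_, ?_, ?_⟩
  · rintro (_ | p)
    · exact ⟨⟨0, by positivity⟩, hnone _⟩
    · exact hcov p
  · rintro (_ | p) (_ | r) h
    · exact h.elim
    · obtain ⟨t, ht⟩ := hcov r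
      exact ⟨t, hnone t, ht⟩
    · obtain ⟨t, ht⟩ := hcov p
      exact ⟨t, ht, hnone t⟩
    · obtain ⟨ha, hg⟩ := h
      obtain ⟨i, hi, hi'⟩ := h2 _ _ hg
      obtain ⟨t, ht, ht'⟩ := idx p.1 i
      exact ⟨t, (hsome t p).2 ⟨ht, ht' ▸ hi⟩, (hsome t r).2 ⟨ht.trans ha, ht' ▸ hi'⟩⟩
  · rintro (_ | p) i j k hij hjk hi hk
    · exact hnone _
    · rw [hsome] at *
      have e1 : (i : ℕ) / m ≤ j / m := Nat.div_le_div_right hij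
      have e2 : (j : ℕ) / m ≤ k / m := Nat.div_le_div_right hjk
      have d1 : (i : ℕ) / m = p.1 := by rw [← hi.1]; rfl
      have d3 : (k : ℕ) / m = p.1 := by rw [← hk.1]; rfl
      have d2 : (j : ℕ) / m = p.1 := by omega
      refine ⟨Fin.ext d2, h3 p.2 i.modNat j.modNat k.modNat ?_ ?_ hi.2 hk.2⟩
      · rw [Fin.le_def, Fin.coe_modNat, Fin.coe_modNat]
        have := Nat.div_add_mod (i : ℕ) m
        have := Nat.div_add_mod (j : ℕ) m
        rw [d1] at *; rw [d2] at *
        have : (i : ℕ) ≤ j := hij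
        omega
      · rw [Fin.le_def, Fin.coe_modNat, Fin.coe_modNat]
        have := Nat.div_add_mod (k : ℕ) m
        have := Nat.div_add_mod (j : ℕ) m
        rw [d3] at *; rw [d2] at *
        have : (j : ℕ) ≤ k := hjk
        omega
  · intro t
    refine le_trans (Finset.card_insert_le _ _) ?_
    have := h4 t.modNat
    have := Finset.card_image_le (s := B t.modNat) (f := fun v => some (t.divNat, v))
    omega

lemma cone_forces {V : Type} (G : SimpleGraph V) (q n k : ℕ) (h : Forces G q n k) :
    Forces (cone G (q + 1)) q n (k + 1) := by
  classical
  intro W H f hfib hhom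
  have hcopy : ∃ a : Fin (q + 1), ∀ v, f (some (a, v)) ≠ f none := by
    by_contra hcon
    push Not at hcon
    choose τ hτ using hcon
    have := hfib (f none) (Finset.univ.image fun a => some (a, τ a)) (by
      intro v hv
      simp only [Finset.mem_image, Finset.mem_univ, true_and] at hv
      obtain ⟨a, rfl⟩ := hv
      exact hτ a)
    rw [Finset.card_image_of_injective _ (fun a b hab => by
      simp only [Option.some.injEq, Prod.mk.injEq] at hab; exact hab.1)] at this
    simp at this
  obtain ⟨a, ha⟩ := hcopy
  obtain ⟨l, c, h1, h2, h3, h4, h5, h6, h7, h8⟩ := h W H (fun v => f (some (a, v)))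
    (by
      intro x s hs
      have := hfib x (s.image fun v => some (a, v)) (by
        intro v hv
        simp only [Finset.mem_image] at hv
        obtain ⟨u, hu, rfl⟩ := hv
        exact hs u hu)
      rwa [Finset.card_image_of_injective _ (fun u v hab => by
        simp only [Option.some.injEq, Prod.mk.injEq] at hab; exact hab.2)] at this)
    (fun u v huv => hhom _ _ ⟨rfl, huv⟩)
  have hadj : ∀ v, H.Adj (f none) (f (some (a, v))) := fun v =>
    (hhom none (some (a, v)) trivial).resolve_left fun e => ha v e.symm
  refine ⟨l, f none :: c, h1, by simp [h2], h3, h4, ?_, ?_, ?_, ?_⟩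
  · rw [List.pairwise_cons]
    refine ⟨fun x hx => ?_, h5⟩
    obtain ⟨v, rfl⟩ := h8 x hx
    exact hadj v
  · intro x hx y hy
    rcases List.mem_cons.1 hy with rfl | hy
    · obtain ⟨v, rfl⟩ := h7 x hx
      exact (hadj v).symm
    · exact h6 x hx y hy
  · intro x hx
    obtain ⟨v, hv⟩ := h7 x hx
    exact ⟨_, hv⟩
  · intro x hx
    rcases List.mem_cons.1 hx with rfl | hx
    · exact ⟨none, rfl⟩
    · obtain ⟨v, hv⟩ := h8 x hx
      exact ⟨_, hv⟩

lemma exists_forces (q n : ℕ) (hn : 1 ≤ n) (k : ℕ) :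
    ∃ (V : Type) (_ : Fintype V) (G : SimpleGraph V),
      HasPathDecompWidthLE G (k + 1) ∧ Forces G q n k := by
  induction k with
  | zero =>
    obtain ⟨m, rfl⟩ : ∃ m, n = m + 1 := ⟨n - 1, by omega⟩
    exact ⟨_, inferInstance, _, path_pd _, path_forces q m⟩
  | succ k ih =>
    obtain ⟨V, _, G, h1, h2⟩ := ih
    exact ⟨_, inferInstance, cone G (q + 1), cone_pd G q _ h1, cone_forces G q n k h2⟩

theorem stmt_6 (k ℓ n : ℕ) (hk : 1 ≤ k) (hℓ : 1 ≤ ℓ) (hn : 1 ≤ n) :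
    ∃ (V : Type) (_ : Fintype V) (G : SimpleGraph V),
      HasPathDecompWidthLE G (k + 1) ∧
      ∀ (W : Type) (H : SimpleGraph W),
        (∃ f : V → W × ℕ × Fin ℓ, Function.Injective f ∧
          ∀ u v : V, G.Adj u v →
            ((f u).1 = (f v).1 ∨ H.Adj (f u).1 (f v).1) ∧
            |((f u).2.1 : ℤ) - ((f v).2.1 : ℤ)| ≤ 1) →
        ∃ g : (Fin n ⊕ Fin k) → W, Function.Injective g ∧
          ∀ u v : Fin n ⊕ Fin k,
            (completeJoin (SimpleGraph.pathGraph n) (⊤ : SimpleGraph (Fin k))).Adj u v →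
            H.Adj (g u) (g v) := by
  classical
  obtain ⟨k, rfl⟩ : ∃ m, k = m + 1 := ⟨k - 1, by omega⟩
  obtain ⟨V, _, G, hpd, hforce⟩ := exists_forces (3 * ℓ) n hn k
  refine ⟨_, inferInstance, cone G (3 * ℓ + 1), cone_pd G _ _ hpd, ?_⟩
  rintro W H ⟨f, hinj, hf⟩
  obtain ⟨l, c, h1, h2, h3, h4, h5, h6, -, -⟩ := cone_forces G (3 * ℓ) n k hforce W H
    (fun v => (f v).1)
    (by
      intro x s hs
      set i := (f none).2.1 with hi
      have hlay : ∀ v, (f v).2.1 ∈ Finset.Icc (i - 1) (i + 1) := by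
        rintro (_ | p)
        · rw [← hi, Finset.mem_Icc]; omega
        · have := (hf none (some p) trivial).2
          rw [abs_le, ← hi] at this
          rw [Finset.mem_Icc]; omega
      calc s.card = (s.image fun v => (f v).2).card := by
            rw [Finset.card_image_of_injOn]
            intro u hu v hv huv
            exact hinj (Prod.ext ((hs u hu).trans (hs v hv).symm) huv)
        _ ≤ (Finset.Icc (i - 1) (i + 1) ×ˢ (Finset.univ : Finset (Fin ℓ))).card := by
            apply Finset.card_le_card
            intro y hy
            obtain ⟨v, _, rfl⟩ := Finset.mem_image.1 hy
            exact Finset.mem_product.2 ⟨hlay v, Finset.mem_univ _⟩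
        _ ≤ 3 * ℓ := by
            rw [Finset.card_product, Nat.card_Icc, Finset.card_univ, Fintype.card_fin]
            exact Nat.mul_le_mul_right _ (by omega))
    (fun u v huv => (hf u v huv).1)
  subst h1
  rw [← h2]
  have hc : ∀ i j : Fin c.length, i ≠ j → H.Adj (c.get i) (c.get j) := by
    intro i j hij
    rw [List.pairwise_iff_get] at h5
    rcases lt_or_gt_of_ne hij with h | h
    · exact h5 i j h
    · exact (h5 j i h).symm
  have hp : ∀ i j : Fin l.length, (i : ℕ) + 1 = j → H.Adj (l.get i) (l.get j) := by
    intro i j hij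
    rw [List.isChain_iff_getElem] at h4
    have := h4 i (by omega)
    simpa [hij] using this
  have hx : ∀ (i : Fin l.length) (j : Fin c.length), H.Adj (l.get i) (c.get j) :=
    fun i j => h6 _ (List.get_mem _ _) _ (List.get_mem _ _)
  refine ⟨Sum.elim l.get c.get, ?_, ?_⟩
  · rintro (i | i) (j | j) h
    · exact congrArg _ (List.nodup_iff_injective_get.1 h3 h)
    · exact absurd h (hx i j).ne
    · exact absurd h (hx j i).ne'
    · by_contra hne
      exact (hc i j fun e => hne (congrArg _ e)).ne h
  · have key : ∀ u v : Fin l.length ⊕ Fin c.length, u ≠ v →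
        ((∃ a b, u = Sum.inl a ∧ v = Sum.inl b ∧ (SimpleGraph.pathGraph l.length).Adj a b) ∨
        (∃ a b, u = Sum.inr a ∧ v = Sum.inr b ∧ (⊤ : SimpleGraph (Fin c.length)).Adj a b) ∨
        (u.isLeft = true ∧ v.isRight = true)) →
        H.Adj (Sum.elim l.get c.get u) (Sum.elim l.get c.get v) := by
      rintro u v hne (⟨a, b, rfl, rfl, h⟩ | ⟨a, b, rfl, rfl, h⟩ | ⟨hu, hv⟩)
      · rw [SimpleGraph.pathGraph_adj] at h
        rcases h with h | h
        · exact hp a b h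
        · exact (hp b a h).symm
      · exact hc a b h.ne
      · obtain ⟨a, rfl⟩ := Sum.isLeft_iff.1 hu
        obtain ⟨b, rfl⟩ := Sum.isRight_iff.1 hv
        exact hx a b
    intro u v huv
    rw [completeJoin, SimpleGraph.fromRel_adj] at huv
    rcases huv.2 with h | h
    · exact key u v huv.1 h
    · exact (key v u huv.1.symm h).symm
end

section
/- For all positive integers i, j, ℓ, n with k = i + j there exists a finite bipartite simple graph G with pathwidth at most k + 1 such that for every simple graph H: if there is an injective map f : V(G) → V(H) × ℕ × Fin ℓ such that for every edge uv of G, writing f(u) = (x, p, s) and f(v) = (y, q, t), one has (x = y or xy ∈ E(H)) and |p − q| ≤ 1 (i.e. G is isomorphic to a subgraph of H ⊠ P ⊠ K_ℓ for the one-way infinite path P on ℕ), then the complete join P_n + K_{i,j} is a 2-small minor of H. -/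
/-- `X` is a `2`-small minor of `H`: there is a model of `X` in `H` in which every branch set
has at most `2` vertices. -/
def TwoSmallMinor {γ δ : Type*} (X : SimpleGraph γ) (H : SimpleGraph δ) : Prop :=
  ∃ μ : γ → H.Subgraph,
    (∀ u : γ, (μ u).verts.Nonempty) ∧
    (∀ u : γ, (μ u).Connected) ∧
    (∀ u v : γ, u ≠ v → Disjoint (μ u).verts (μ v).verts) ∧
    (∀ u v : γ, X.Adj u v → ∃ a ∈ (μ u).verts, ∃ b ∈ (μ v).verts, H.Adj a b) ∧
    (∀ u : γ, (μ u).verts.ncard ≤ 2)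

open Classical in
/-- Pigeonhole: few bad positions leave a long clean block. -/
lemma gap_lemma (q L : ℕ) (s : ℕ) (bad : ℕ → Prop)
    (hq : ((Finset.Ico s (s + (q+1)*(L+1))).filter bad).card ≤ q) :
    ∃ t, s ≤ t ∧ t + L < s + (q+1)*(L+1) ∧ ∀ u, t ≤ u → u ≤ t + L → ¬ bad u := by
  by_contra hcon
  push Not at hcon
  have h1 : ∀ r : ℕ, ∃ u, r < q + 1 → s + r*(L+1) ≤ u ∧ u ≤ s + r*(L+1) + L ∧ bad u := by
    intro r
    by_cases hr : r < q + 1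
    · have hle : (r+1)*(L+1) ≤ (q+1)*(L+1) := Nat.mul_le_mul_right _ hr
      obtain ⟨u, hu⟩ := hcon (s + r*(L+1)) (by omega) (by rw [add_mul] at hle; omega)
      exact ⟨u, fun _ => hu⟩
    · exact ⟨0, fun h => absurd h hr⟩
  choose g hg using h1
  have h2 : (Finset.range (q+1)).card ≤ ((Finset.Ico s (s + (q+1)*(L+1))).filter bad).card := by
    apply Finset.card_le_card_of_injOn g
    · intro r hr
      have hr' : r < q + 1 := by simpa using hr
      obtain ⟨ha, hb, hc⟩ := hg r hr'
      have hle : (r+1)*(L+1) ≤ (q+1)*(L+1) := Nat.mul_le_mul_right _ hr'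
      rw [add_mul] at hle
      simp only [Finset.coe_filter, Finset.mem_Ico, Set.mem_setOf_eq]
      refine ⟨⟨by omega, by omega⟩, hc⟩
    · have key : ∀ r r', r < q+1 → r' < q+1 → r < r' → g r ≠ g r' := by
        intro r r' hr hr' hlt heq
        obtain ⟨_, hb, _⟩ := hg r hr
        obtain ⟨ha, _, _⟩ := hg r' hr'
        have hle : (r+1)*(L+1) ≤ r'*(L+1) := Nat.mul_le_mul_right _ hlt
        rw [add_mul] at hle
        omega
      intro r hr r' hr' heq
      have hr1 : r < q + 1 := by simpa using hr
      have hr2 : r' < q + 1 := by simpa using hr'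
      rcases lt_trichotomy r r' with h | h | h
      · exact absurd heq (key r r' hr1 hr2 h)
      · exact h
      · exact absurd heq.symm (key r' r hr2 hr1 h)
  rw [Finset.card_range] at h2
  omega

open Classical in
/-- A long walk which visits every vertex a bounded number of times contains a long path. -/
lemma walk_lemma (C m : ℕ) : ∃ N : ℕ, 1 ≤ N ∧ ∀ (W : Type) (x : ℕ → W) (s : ℕ),
    (∀ y, ((Finset.Ico s (s+N)).filter (fun t => x t = y)).card ≤ C) →
    ∃ L : List W, L.length = m ∧ L.Nodup ∧
      List.IsChain (fun a b => ∃ t, s ≤ t ∧ t + 1 < s + N ∧ x t = a ∧ x (t+1) = b) (x s :: L) ∧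
      x s ∉ L ∧
      ∀ y ∈ L, ∃ t, s ≤ t ∧ t < s + N ∧ x t = y := by
  induction m with
  | zero =>
    refine ⟨1, le_refl _, fun W x s _ => ⟨[], ?_⟩⟩
    simp
  | succ m ih =>
    obtain ⟨N, hN, ih⟩ := ih
    refine ⟨(C+1)*(N+1), by nlinarith, fun W x s hx => ?_⟩
    obtain ⟨t, hst, htN, hgap⟩ := gap_lemma C N s (fun t => x t = x s) (hx (x s))
    have hts : s < t := by
      rcases Nat.lt_or_ge s t with h | h
      · exact h
      · exact absurd (by rw [le_antisymm h hst]) (hgap t le_rfl (by omega))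
    let F := (Finset.Ico s t).filter (fun u => x u = x s)
    have hF : F.Nonempty := ⟨s, by simp [F, hts]⟩
    obtain ⟨t0, ht0F, ht0⟩ := F.exists_max_image id hF
    have ht0' : s ≤ t0 ∧ t0 < t ∧ x t0 = x s := by
      simpa [F, and_assoc] using ht0F
    have hclean : ∀ u, t0 < u → u ≤ t + N → x u ≠ x s := by
      intro u hu hu2 heq
      by_cases hut : u < t
      · have := ht0 u (by simp [F, heq, hut]; omega)
        simp at this; omega
      · exact hgap u (by omega) hu2 heq
    obtain ⟨L, hlen, hnd, hch, hnot, hmem⟩ := ih W x (t0+1) (by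
      intro y
      refine le_trans (Finset.card_le_card ?_) (hx y)
      apply Finset.filter_subset_filter
      apply Finset.Ico_subset_Ico <;> omega)
    refine ⟨x (t0+1) :: L, by simp [hlen], List.nodup_cons.2 ⟨hnot, hnd⟩, ?_, ?_, ?_⟩
    · rw [List.isChain_cons_cons]
      refine ⟨⟨t0, by omega, by omega, ht0'.2.2, rfl⟩, ?_⟩
      refine hch.imp ?_
      rintro a b ⟨u, h1, h2, h3, h4⟩
      exact ⟨u, by omega, by omega, h3, h4⟩
    · rw [List.mem_cons]
      rintro (h | h)
      · exact hclean (t0+1) (by omega) (by omega) h.symm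
      · obtain ⟨u, h1, h2, h3⟩ := hmem _ h
        exact hclean u (by omega) (by omega) h3
    · intro y hy
      rw [List.mem_cons] at hy
      rcases hy with rfl | hy
      · exact ⟨t0+1, by omega, by omega, rfl⟩
      · obtain ⟨u, h1, h2, h3⟩ := hmem _ hy
        exact ⟨u, by omega, by omega, h3⟩

open Classical in
/-- The forcing property: every contraction-like map `φ` with small fibres exhibits `k` hubs of
prescribed colours and `n` coloured pairs forming a path, all images being distinct and
outside `S`. -/
def Force {V : Type} [Fintype V] (G : SimpleGraph V) (col : V → Bool) (n C s k : ℕ)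
    (κ : Fin k → Bool) : Prop :=
  ∀ (W : Type) (H : SimpleGraph W) (φ : V → W) (S : Finset W),
    (∀ y, (Finset.univ.filter (fun v => φ v = y)).card ≤ C) →
    (∀ u v, G.Adj u v → φ u = φ v ∨ H.Adj (φ u) (φ v)) →
    S.card ≤ s →
    ∃ (hub : Fin k → V) (p : Fin n → Bool → V),
      (∀ a, col (hub a) = κ a) ∧ (∀ r b, col (p r b) = b) ∧
      (∀ a, φ (hub a) ∉ S) ∧ (∀ r b, φ (p r b) ∉ S) ∧
      (∀ a a', φ (hub a) = φ (hub a') → a = a') ∧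
      (∀ r b r' b', φ (p r b) = φ (p r' b') → r = r' ∧ b = b') ∧
      (∀ a r b, φ (hub a) ≠ φ (p r b)) ∧
      (∀ a a', κ a ≠ κ a' → G.Adj (hub a) (hub a')) ∧
      (∀ a r b, κ a ≠ b → G.Adj (hub a) (p r b)) ∧
      (∀ r, G.Adj (p r false) (p r true)) ∧
      (∀ r r' : Fin n, r.val + 1 = r'.val → ∃ b b', H.Adj (φ (p r b)) (φ (p r' b')))

/-- `M` disjoint copies of `G`, each with a new apex adjacent to all vertices of
colour different from `c`. -/
def extG {V : Type} (M : ℕ) (G : SimpleGraph V) (col : V → Bool) (c : Bool) :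
    SimpleGraph (Fin M × Option V) where
  Adj x y := x.1 = y.1 ∧
    match x.2, y.2 with
    | none, none => False
    | none, some v => col v ≠ c
    | some v, none => col v ≠ c
    | some u, some v => G.Adj u v
  symm := ⟨by
    rintro ⟨a, u⟩ ⟨b, v⟩ ⟨h, h'⟩
    refine ⟨h.symm, ?_⟩
    cases u <;> cases v <;> simp_all [G.adj_comm]⟩
  loopless := ⟨by
    rintro ⟨a, u⟩ ⟨h, h'⟩
    cases u <;> simp_all⟩

/-- The colouring of `extG`. -/
def extCol {V : Type} (M : ℕ) (col : V → Bool) (c : Bool) : Fin M × Option V → Bool :=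
  fun x => x.2.elim c col

lemma ext_pd {V : Type} [Nonempty V] (M w : ℕ) (G : SimpleGraph V) (col : V → Bool) (c : Bool)
    (h : HasPathDecompWidthLE G w) : HasPathDecompWidthLE (extG M G col c) (w+1) := by
  classical
  obtain ⟨m, B, h1, h2, h3, h4⟩ := h
  have hdm : ∀ (a : Fin M) (i : Fin m), (finProdFinEquiv (a, i)).divNat = a ∧
      (finProdFinEquiv (a, i)).modNat = i := by
    intro a i
    have := finProdFinEquiv.symm_apply_apply (a, i)
    rw [finProdFinEquiv_symm_apply] at this
    exact ⟨congrArg Prod.fst this, congrArg Prod.snd this⟩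
  let B' : Fin (M * m) → Finset (Fin M × Option V) := fun t =>
    insert (t.divNat, none) ((B t.modNat).image (fun v => (t.divNat, some v)))
  have mem_none : ∀ a t, (a, none) ∈ B' t ↔ a = t.divNat := by
    intro a t; simp [B']
  have mem_some : ∀ a v t, (a, some v) ∈ B' t ↔ a = t.divNat ∧ v ∈ B t.modNat := by
    intro a v t; simp [B']; tauto
  refine ⟨M * m, B', ?_, ?_, ?_, ?_⟩
  · rintro ⟨a, _ | v⟩
    · obtain ⟨i, hi⟩ := h1 (Classical.arbitrary V)
      exact ⟨finProdFinEquiv (a, i), by rw [mem_none, (hdm a i).1]⟩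
    · obtain ⟨i, hi⟩ := h1 v
      exact ⟨finProdFinEquiv (a, i), by rw [mem_some, (hdm a i).1, (hdm a i).2]; exact ⟨rfl, hi⟩⟩
  · rintro ⟨a, u⟩ ⟨b, v⟩ ⟨hab, huv⟩
    obtain rfl : a = b := hab
    rcases u with _ | u <;> rcases v with _ | v
    · exact absurd huv (by simp)
    · obtain ⟨i, hi⟩ := h1 v
      refine ⟨finProdFinEquiv (a, i), ?_, ?_⟩
      · rw [mem_none, (hdm a i).1]
      · rw [mem_some, (hdm a i).1, (hdm a i).2]; exact ⟨rfl, hi⟩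
    · obtain ⟨i, hi⟩ := h1 u
      refine ⟨finProdFinEquiv (a, i), ?_, ?_⟩
      · rw [mem_some, (hdm a i).1, (hdm a i).2]; exact ⟨rfl, hi⟩
      · rw [mem_none, (hdm a i).1]
    · obtain ⟨i, hi, hi'⟩ := h2 u v huv
      refine ⟨finProdFinEquiv (a, i), ?_, ?_⟩
      · rw [mem_some, (hdm a i).1, (hdm a i).2]; exact ⟨rfl, hi⟩
      · rw [mem_some, (hdm a i).1, (hdm a i).2]; exact ⟨rfl, hi'⟩
  · have hdiv : ∀ (a : Fin M) (x y z : Fin (M*m)), x ≤ y → y ≤ z → a = x.divNat → a = z.divNat →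
        a = y.divNat := by
      intro a x y z hxy hyz hx hz
      have e1 : a.val = x.val / m := by rw [hx]; rfl
      have e2 : a.val = z.val / m := by rw [hz]; rfl
      have e3 : x.val / m ≤ y.val / m := Nat.div_le_div_right hxy
      have e4 : y.val / m ≤ z.val / m := Nat.div_le_div_right hyz
      apply Fin.ext
      change a.val = y.val / m
      omega
    rintro ⟨a, _ | v⟩ x y z hxy hyz hx hz
    · rw [mem_none] at *
      exact hdiv a x y z hxy hyz hx hz
    · rw [mem_some] at *
      have hy := hdiv a x y z hxy hyz hx.1 hz.1
      refine ⟨hy, h3 v x.modNat y.modNat z.modNat ?_ ?_ hx.2 hz.2⟩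
      · have e1 : a.val = x.val / m := by rw [hx.1]; rfl
        have e2 : a.val = y.val / m := by rw [hy]; rfl
        have e3 := Nat.div_add_mod x.val m
        have e4 := Nat.div_add_mod y.val m
        change x.val % m ≤ y.val % m
        have : x.val ≤ y.val := hxy
        rw [← e1] at e3
        rw [← e2] at e4
        omega
      · have e1 : a.val = z.val / m := by rw [hz.1]; rfl
        have e2 : a.val = y.val / m := by rw [hy]; rfl
        have e3 := Nat.div_add_mod z.val m
        have e4 := Nat.div_add_mod y.val m
        change y.val % m ≤ z.val % m
        have : y.val ≤ z.val := hyz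
        rw [← e1] at e3
        rw [← e2] at e4
        omega
  · intro t
    refine le_trans (Finset.card_insert_le _ _) ?_
    have := le_trans (Finset.card_image_le (s := B t.modNat)
      (f := fun v => ((t.divNat, some v) : Fin M × Option V))) (h4 t.modNat)
    omega

lemma ext_proper {V : Type} (M : ℕ) (G : SimpleGraph V) (col : V → Bool) (c : Bool)
    (h : ∀ u v, G.Adj u v → col u ≠ col v) :
    ∀ u v, (extG M G col c).Adj u v → extCol M col c u ≠ extCol M col c v := by
  rintro ⟨a, u⟩ ⟨b, v⟩ ⟨hab, huv⟩
  rcases u with _ | u <;> rcases v with _ | v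
  · exact absurd huv (by simp)
  · exact fun h => huv h.symm
  · exact huv
  · exact h u v huv

lemma ext_force {V : Type} [Fintype V] (G : SimpleGraph V) (col : V → Bool) (n C s k : ℕ)
    (κ : Fin (k+1) → Bool) (h : Force G col n C (s+1) k (fun a => κ a.succ)) :
    Force (extG (C*s+1) G col (κ 0)) (extCol (C*s+1) col (κ 0)) n C s (k+1) κ := by
  classical
  intro W H φ S hfib hhom hS
  obtain ⟨m, hm⟩ : ∃ m : Fin (C*s+1), φ (m, none) ∉ S := by
    by_contra hcon
    push Not at hcon
    have h1 := Finset.card_le_mul_card_image_of_maps_to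
      (s := (Finset.univ : Finset (Fin (C*s+1)))) (t := S) (f := fun m => φ (m, none))
      (fun m _ => hcon m) C (by
        intro y _
        refine le_trans ?_ (hfib y)
        apply Finset.card_le_card_of_injOn (fun m => (m, none))
        · intro m hm
          simpa using hm
        · intro m _ m' _ hmm
          simpa using hmm)
    rw [Finset.card_univ, Fintype.card_fin] at h1
    have : C * S.card ≤ C * s := Nat.mul_le_mul_left _ hS
    omega
  obtain ⟨hub, p, c1, c2, s1, s2, i1, i2, i3, g1, g2, g3, g4⟩ := h W H (fun v => φ (m, some v))
    (insert (φ (m, none)) S)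
    (by
      intro y
      refine le_trans ?_ (hfib y)
      apply Finset.card_le_card_of_injOn (fun v => (m, some v))
      · intro v hv
        simpa using hv
      · intro v _ v' _ hvv
        simpa using hvv)
    (fun u v huv => hhom _ _ ⟨rfl, huv⟩)
    (le_trans (Finset.card_insert_le _ _) (by omega))
  simp only [Finset.mem_insert, not_or] at s1 s2
  refine ⟨Fin.cases (m, none) (fun a => (m, some (hub a))), fun r b => (m, some (p r b)),
    ?_, c2, ?_, fun r b => (s2 r b).2, ?_, i2, ?_, ?_, ?_, ?_, g4⟩
  · intro a
    refine Fin.cases rfl (fun a => c1 a) a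
  · intro a
    refine Fin.cases hm (fun a => (s1 a).2) a
  · intro a a'
    refine Fin.cases ?_ (fun a => ?_) a <;> refine Fin.cases ?_ (fun a' => ?_) a'
    · intro _; rfl
    · intro h; exact absurd h.symm (s1 a').1
    · intro h; exact absurd h (s1 a).1
    · intro h; rw [i1 a a' h]
  · intro a r b
    refine Fin.cases ?_ (fun a => ?_) a
    · intro h; exact (s2 r b).1 h.symm
    · exact i3 a r b
  · intro a a'
    refine Fin.cases ?_ (fun a => ?_) a <;> refine Fin.cases ?_ (fun a' => ?_) a'
    · intro h; exact absurd rfl h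
    · intro h; exact ⟨rfl, by change col (hub a') ≠ κ 0; rw [c1]; exact h.symm⟩
    · intro h; exact ⟨rfl, by change col (hub a) ≠ κ 0; rw [c1]; exact h⟩
    · intro h; exact ⟨rfl, g1 a a' h⟩
  · intro a r b
    refine Fin.cases ?_ (fun a => ?_) a
    · intro h; exact ⟨rfl, by change col (p r b) ≠ κ 0; rw [c2]; exact h.symm⟩
    · intro h; exact ⟨rfl, g2 a r b h⟩
  · intro r; exact ⟨rfl, g3 r⟩

/-- The induction package. -/
def Good (n C s k : ℕ) (κ : Fin k → Bool) : Prop :=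
  ∃ (V : Type) (_ : Fintype V) (G : SimpleGraph V) (col : V → Bool),
    (∀ u v, G.Adj u v → col u ≠ col v) ∧ (∀ u, ∃ v, G.Adj u v) ∧ (∀ b, ∃ v, col v = b) ∧
    HasPathDecompWidthLE G (k+1) ∧ Force G col n C s k κ

lemma bool_aux : ∀ a b c : Bool, a ≠ c → a ≠ b → c = b := by decide

set_option maxHeartbeats 1000000 in
lemma good_zero (n C s : ℕ) (κ : Fin 0 → Bool) : Good n C s 0 κ := by
  classical
  obtain ⟨L, hL, hwalk⟩ := walk_lemma C (2*n)
  obtain ⟨N, hNdef⟩ : ∃ N, N = (C*s+1)*(L+1) := ⟨_, rfl⟩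
  have hN2 : 2 ≤ N := by nlinarith [Nat.zero_le (C*s)]
  let col : Fin N → Bool := fun t => decide (t.val % 2 = 1)
  have hproper : ∀ u v, (SimpleGraph.pathGraph N).Adj u v → col u ≠ col v := by
    intro u v huv
    rw [SimpleGraph.pathGraph_adj] at huv
    simp only [col, ne_eq, decide_eq_decide]
    omega
  refine ⟨Fin N, inferInstance, SimpleGraph.pathGraph N, col, hproper, ?_, ?_, ?_, ?_⟩
  · intro u
    by_cases hu : u.val + 1 < N
    · exact ⟨⟨u.val+1, hu⟩, by rw [SimpleGraph.pathGraph_adj]; simp⟩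
    · exact ⟨⟨u.val-1, by omega⟩, by rw [SimpleGraph.pathGraph_adj]; simp; omega⟩
  · intro b
    cases b
    · exact ⟨⟨0, by omega⟩, by simp [col]⟩
    · exact ⟨⟨1, by omega⟩, by simp [col]⟩
  · refine ⟨N, fun t => Finset.univ.filter (fun v => v.val = t.val ∨ v.val = t.val + 1),
      ?_, ?_, ?_, ?_⟩
    · intro v; exact ⟨v, by simp⟩
    · intro u v huv
      rw [SimpleGraph.pathGraph_adj] at huv
      rcases huv with h | h
      · exact ⟨u, by simp; omega⟩
      · exact ⟨v, by simp; omega⟩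
    · intro v i j k hij hjk hi hk
      have h1 : i.val ≤ j.val := hij
      have h2 : j.val ≤ k.val := hjk
      simp only [Finset.mem_filter, Finset.mem_univ, true_and] at *
      omega
    · intro t
      have : (Finset.univ.filter (fun v : Fin N => v.val = t.val ∨ v.val = t.val + 1)).card ≤
          ({t.val, t.val+1} : Finset ℕ).card := by
        apply Finset.card_le_card_of_injOn (fun v => v.val)
        · intro v hv
          simpa using hv
        · intro v _ v' _ h
          exact Fin.ext h
      exact le_trans this (Finset.card_le_two)
  · intro W H φ S hfib hhom hS
    let g : ℕ → Fin N := fun t => ⟨t % N, Nat.mod_lt _ (by omega)⟩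
    have hg : ∀ t, t < N → (g t).val = t := fun t ht => Nat.mod_eq_of_lt ht
    have hginj : ∀ t t', t < N → t' < N → g t = g t' → t = t' := by
      intro t t' h h' e
      rw [← hg t h, ← hg t' h', e]
    have hadj : ∀ t, t + 1 < N → (SimpleGraph.pathGraph N).Adj (g t) (g (t+1)) := by
      intro t ht
      rw [SimpleGraph.pathGraph_adj, hg t (by omega), hg (t+1) ht]
      simp
    have hfib' : ∀ y, ((Finset.range N).filter (fun t => φ (g t) = y)).card ≤ C := by
      intro y
      refine le_trans ?_ (hfib y)
      apply Finset.card_le_card_of_injOn g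
      · intro t ht
        simp at ht
        simpa using ht.2
      · intro t ht t' ht' h
        simp at ht ht'
        exact hginj t t' ht.1 ht'.1 h
    have hbad : ((Finset.Ico 0 (0 + (C*s+1)*(L+1))).filter (fun t => φ (g t) ∈ S)).card ≤ C*s := by
      have h1 := Finset.card_le_mul_card_image_of_maps_to
        (s := (Finset.Ico 0 (0 + (C*s+1)*(L+1))).filter (fun t => φ (g t) ∈ S)) (t := S)
        (f := fun t => φ (g t)) (fun t ht => (Finset.mem_filter.1 ht).2) C (by
          intro y _
          refine le_trans (Finset.card_le_card ?_) (hfib' y)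
          intro t ht
          simp only [Finset.mem_filter, Finset.mem_Ico, Finset.mem_range] at ht ⊢
          exact ⟨by omega, ht.2⟩)
      exact le_trans h1 (Nat.mul_le_mul_left _ hS)
    obtain ⟨t0, _, ht0, hclean⟩ := gap_lemma (C*s) L 0 (fun t => φ (g t) ∈ S)
      (by convert hbad)
    have ht0N : t0 + L < N := by omega
    obtain ⟨P, hlen, hnd, hch, hnot, hmem⟩ := hwalk W (fun t => φ (g t)) t0 (by
      intro y
      refine le_trans (Finset.card_le_card ?_) (hfib' y)
      intro t ht
      simp only [Finset.mem_filter, Finset.mem_Ico, Finset.mem_range] at ht ⊢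
      exact ⟨by omega, ht.2⟩)
    replace hch := (List.isChain_cons.1 hch).2
    rw [List.isChain_iff_getElem] at hch
    have hinj : ∀ a b (ha : a < P.length) (hb : b < P.length), P[a] = P[b] → a = b := by
      intro a b ha hb h
      exact (List.Nodup.getElem_inj_iff hnd).1 h
    have hstep : ∀ r : Fin n, ∃ t, t0 ≤ t ∧ t + 1 < t0 + L ∧
        φ (g t) = P[2*r.val]'(by omega) ∧ φ (g (t+1)) = P[2*r.val+1]'(by omega) := by
      intro r
      exact hch (2*r.val) (by omega)
    choose τ hτ0 hτ1 hτ2 hτ3 using hstep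
    have hcolne : ∀ r, col (g (τ r)) ≠ col (g (τ r + 1)) := fun r =>
      hproper _ _ (hadj _ (by have := hτ1 r; omega))
    let p : Fin n → Bool → Fin N := fun r b => if col (g (τ r)) = b then g (τ r) else g (τ r + 1)
    have hp : ∀ r b, ∃ e : ℕ, e ≤ 1 ∧ p r b = g (τ r + e) ∧
        ∃ he : 2*r.val + e < P.length, φ (p r b) = P[2*r.val+e] := by
      intro r b
      by_cases h : col (g (τ r)) = b
      · exact ⟨0, by omega, by simp [p, h], by omega, by simp [p, h, hτ2]⟩
      · exact ⟨1, by omega, by simp [p, h], by omega, by simp [p, h, hτ3]⟩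
    have hpcol : ∀ r b, col (p r b) = b := by
      intro r b
      have := hcolne r
      by_cases h : col (g (τ r)) = b
      · simp [p, h]
      · simp only [p, h, if_false]
        exact bool_aux _ _ _ this h
    refine ⟨fun a => a.elim0, p, fun a => a.elim0, hpcol, fun a => a.elim0, ?_, fun a => a.elim0,
      ?_, fun a => a.elim0, fun a => a.elim0, fun a => a.elim0, ?_, ?_⟩
    · intro r b
      obtain ⟨e, he, hpe, _⟩ := hp r b
      rw [hpe]
      have h0 := hτ0 r
      have h1 := hτ1 r
      exact hclean _ (by omega) (by omega)
    · intro r b r' b' h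
      obtain ⟨e, he, hpe, hle, hP⟩ := hp r b
      obtain ⟨e', he', hpe', hle', hP'⟩ := hp r' b'
      have h2 := hinj _ _ hle hle' (by rw [← hP, ← hP', h])
      have h3 : r = r' := Fin.ext (by omega)
      subst h3
      have h4 : e = e' := by omega
      subst h4
      refine ⟨rfl, ?_⟩
      rw [← hpcol r b, ← hpcol r b', hpe, hpe']
    · intro r
      have hA := hadj (τ r) (by have := hτ1 r; omega)
      have hc := hcolne r
      cases h1 : col (g (τ r))
      · simpa [p, h1] using hA
      · simpa [p, h1] using hA.symm
    · intro r r' hrr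
      obtain ⟨t, ht1, ht2, ht3, ht4⟩ := hch (2*r.val+1) (by omega)
      refine ⟨col (g (τ r + 1)), col (g (τ r')), ?_⟩
      have e1 : p r (col (g (τ r + 1))) = g (τ r + 1) := by
        simp only [p, hcolne r, if_false]
      have e2 : p r' (col (g (τ r'))) = g (τ r') := by simp [p]
      have e3 : 2 * r'.val = 2*r.val+1+1 := by omega
      have e4 : φ (g (τ r')) = P[2*r.val+1+1]'(by omega) := by
        rw [hτ2 r']; simp only [e3]
      rw [e1, e2, hτ3, e4, ← ht3, ← ht4]
      rcases hhom _ _ (hadj t (by omega)) with h | h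
      · exfalso
        have h5 := hinj (2*r.val+1) (2*r.val+1+1) (by omega) (by omega)
          (ht3.symm.trans (h.trans ht4))
        omega
      · exact h

lemma ext_noiso {V : Type} (M : ℕ) (G : SimpleGraph V) (col : V → Bool) (c : Bool)
    (h2 : ∀ u, ∃ v, G.Adj u v) (h3 : ∀ b, ∃ v, col v = b) :
    ∀ u, ∃ v, (extG M G col c).Adj u v := by
  rintro ⟨a, _ | v⟩
  · obtain ⟨v, hv⟩ := h3 (!c)
    exact ⟨(a, some v), rfl, by change col v ≠ c; rw [hv]; simp⟩
  · obtain ⟨w, hw⟩ := h2 v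
    exact ⟨(a, some w), rfl, hw⟩

lemma good_all (n C k : ℕ) : ∀ (s : ℕ) (κ : Fin k → Bool), Good n C s k κ := by
  induction k with
  | zero => exact fun s κ => good_zero n C s κ
  | succ k ih =>
    intro s κ
    obtain ⟨V, _, G, col, h1, h2, h3, h4, h5⟩ := ih (s+1) (fun a => κ a.succ)
    haveI : Nonempty V := ⟨(h3 true).choose⟩
    refine ⟨Fin (C*s+1) × Option V, inferInstance, extG (C*s+1) G col (κ 0), extCol _ col (κ 0),
      ext_proper _ G col _ h1, ext_noiso _ G col _ h2 h3, ?_, ext_pd _ _ G col _ h4,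
      ext_force G col n C s k κ h5⟩
    intro b
    obtain ⟨v, hv⟩ := h3 b
    exact ⟨(0, some v), hv⟩

lemma minor_of_force {V W : Type} (G : SimpleGraph V) (H : SimpleGraph W) (i j n : ℕ)
    (φ : V → W) (hhom : ∀ u v, G.Adj u v → φ u = φ v ∨ H.Adj (φ u) (φ v))
    (κ : Fin i ⊕ Fin j → Bool) (hκ : ∀ a b, κ (Sum.inl a) ≠ κ (Sum.inr b))
    (hub : Fin i ⊕ Fin j → V) (p : Fin n → Bool → V)
    (i1 : ∀ a a', φ (hub a) = φ (hub a') → a = a')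
    (i2 : ∀ r b r' b', φ (p r b) = φ (p r' b') → r = r' ∧ b = b')
    (i3 : ∀ a r b, φ (hub a) ≠ φ (p r b))
    (g1 : ∀ a a', κ a ≠ κ a' → G.Adj (hub a) (hub a'))
    (g2 : ∀ a r b, κ a ≠ b → G.Adj (hub a) (p r b))
    (g3 : ∀ r, G.Adj (p r false) (p r true))
    (g4 : ∀ r r' : Fin n, r.val + 1 = r'.val → ∃ b b', H.Adj (φ (p r b)) (φ (p r' b'))) :
    TwoSmallMinor
      (completeJoin (SimpleGraph.pathGraph n) (completeBipartiteGraph (Fin i) (Fin j))) H := by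
  have hpair : ∀ r, H.Adj (φ (p r false)) (φ (p r true)) := by
    intro r
    rcases hhom _ _ (g3 r) with h | h
    · exact absurd (i2 _ _ _ _ h).2 (by simp)
    · exact h
  let μ : Fin n ⊕ (Fin i ⊕ Fin j) → H.Subgraph := fun u =>
    match u with
    | Sum.inl r => H.subgraphOfAdj (hpair r)
    | Sum.inr a => H.singletonSubgraph (φ (hub a))
  have memP : ∀ r b, φ (p r b) ∈ (μ (Sum.inl r)).verts := by
    intro r b
    cases b <;> simp [μ]
  have memP' : ∀ r x, x ∈ (μ (Sum.inl r)).verts → ∃ b, x = φ (p r b) := by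
    intro r x hx
    have : x = φ (p r false) ∨ x = φ (p r true) := by simpa [μ] using hx
    rcases this with h | h
    · exact ⟨_, h⟩
    · exact ⟨_, h⟩
  have memH : ∀ a, φ (hub a) ∈ (μ (Sum.inr a)).verts := by
    intro a; simp [μ]
  have memH' : ∀ a x, x ∈ (μ (Sum.inr a)).verts → x = φ (hub a) := by
    intro a x hx; simpa [μ] using hx
  have hconn : ∀ u, (μ u).Connected := by
    rintro (r | a)
    · exact SimpleGraph.Subgraph.subgraphOfAdj_connected _
    · exact SimpleGraph.Subgraph.singletonSubgraph_connected
  have hHH : ∀ a b, H.Adj (φ (hub (Sum.inl a))) (φ (hub (Sum.inr b))) := by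
    intro a b
    rcases hhom _ _ (g1 _ _ (hκ a b)) with h | h
    · exact absurd (i1 _ _ h) (by simp)
    · exact h
  have hHP : ∀ a r, ∃ b, H.Adj (φ (hub a)) (φ (p r b)) := by
    intro a r
    refine ⟨!(κ a), ?_⟩
    rcases hhom _ _ (g2 a r (!(κ a)) (by simp)) with h | h
    · exact absurd h (i3 _ _ _)
    · exact h
  have hrel : ∀ u v, ((∃ a b, u = Sum.inl a ∧ v = Sum.inl b ∧ (SimpleGraph.pathGraph n).Adj a b) ∨
    (∃ a b, u = Sum.inr a ∧ v = Sum.inr b ∧ (completeBipartiteGraph (Fin i) (Fin j)).Adj a b) ∨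
    (u.isLeft = true ∧ v.isRight = true)) →
      ∃ a ∈ (μ u).verts, ∃ b ∈ (μ v).verts, H.Adj a b := by
    rintro u v (⟨a, b, rfl, rfl, hab⟩ | ⟨a, b, rfl, rfl, hab⟩ | ⟨hu, hv⟩)
    · rw [SimpleGraph.pathGraph_adj] at hab
      rcases hab with h | h
      · obtain ⟨c, c', hc⟩ := g4 a b h
        exact ⟨_, memP _ _, _, memP _ _, hc⟩
      · obtain ⟨c, c', hc⟩ := g4 b a h
        exact ⟨_, memP _ _, _, memP _ _, hc.symm⟩
    · rcases a with a | a <;> rcases b with b | b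
      · simp at hab
      · exact ⟨_, memH _, _, memH _, hHH a b⟩
      · exact ⟨_, memH _, _, memH _, (hHH b a).symm⟩
      · simp at hab
    · rcases u with r | u <;> rcases v with v | a
      · simp at hv
      · obtain ⟨b, hb⟩ := hHP a r
        exact ⟨_, memP _ _, _, memH _, hb.symm⟩
      · simp at hu
      · simp at hu
  refine ⟨μ, ?_, hconn, ?_, ?_, ?_⟩
  · rintro (r | a)
    · exact ⟨_, memP r true⟩
    · exact ⟨_, memH a⟩
  · rintro (r | a) (r' | a') hne <;> rw [Set.disjoint_left] <;> intro x hx hx'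
    · obtain ⟨b, rfl⟩ := memP' _ _ hx
      obtain ⟨b', hb'⟩ := memP' _ _ hx'
      exact hne (by rw [(i2 _ _ _ _ hb').1])
    · obtain ⟨b, rfl⟩ := memP' _ _ hx
      exact i3 _ _ _ (memH' _ _ hx').symm
    · obtain ⟨b, rfl⟩ := memP' _ _ hx'
      exact i3 _ _ _ (memH' _ _ hx).symm
    · have h1 := memH' _ _ hx
      have h2 := memH' _ _ hx'
      exact hne (by rw [i1 _ _ (h1.symm.trans h2)])
  · intro u v huv
    rcases huv with ⟨_, h | h⟩
    · exact hrel u v h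
    · obtain ⟨a, ha, b, hb, hab⟩ := hrel v u h
      exact ⟨b, hb, a, ha, hab.symm⟩
  · rintro (r | a)
    · have : (μ (Sum.inl r)).verts = {φ (p r false), φ (p r true)} := by simp [μ]
      rw [this]
      exact le_trans (Set.ncard_insert_le _ _) (by simp)
    · have : (μ (Sum.inr a)).verts = {φ (hub a)} := by simp [μ]
      rw [this]; simp

lemma fibre_bound {V W : Type} [Fintype V] (ℓ : ℕ) (c : ℕ) (f : V → W × ℕ × Fin ℓ)
    (hf : Function.Injective f) (hc : ∀ v, |((f v).2.1 : ℤ) - c| ≤ 2) (y : W)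
    [DecidablePred fun v => (f v).1 = y] :
    (Finset.univ.filter (fun v => (f v).1 = y)).card ≤ 5*ℓ := by
  have : (Finset.univ.filter (fun v => (f v).1 = y)).card ≤
      ((Finset.Icc (c-2 : ℤ) (c+2)) ×ˢ (Finset.univ : Finset (Fin ℓ))).card := by
    apply Finset.card_le_card_of_injOn (fun v => (((f v).2.1 : ℤ), (f v).2.2))
    · intro v _
      have := abs_le.1 (hc v)
      simp only [Finset.coe_product, Set.mem_prod, Finset.coe_Icc, Set.mem_Icc, Finset.coe_univ,
        Set.mem_univ, and_true]
      omega
    · intro v hv v' hv' h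
      simp at hv hv' h
      apply hf
      ext1
      · rw [hv, hv']
      · ext1
        · exact h.1
        · exact h.2
  refine le_trans this ?_
  rw [Finset.card_product, Int.card_Icc, Finset.card_univ, Fintype.card_fin]
  have : ((c:ℤ)+2+1-(c-2)).toNat = 5 := by omega
  rw [this]

/-- For all `i, j, ℓ, n ≥ 1` with `k = i + j` there is a finite bipartite graph
`G` of pathwidth at most `k + 1` such that for every graph `H`: if `G` is isomorphic to a
subgraph of `H ⊠ P ⊠ K_ℓ` (for the one-way infinite path `P` on `ℕ`), then the complete join
`P_n + K_{i,j}` is a `2`-small minor of `H`. -/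
theorem stmt_7 (i j k ℓ n : ℕ) (hi : 1 ≤ i) (hj : 1 ≤ j) (hℓ : 1 ≤ ℓ) (hn : 1 ≤ n)
    (hk : k = i + j) :
    ∃ (V : Type) (_ : Fintype V) (G : SimpleGraph V),
      (∃ c : V → Fin 2, ∀ u v : V, G.Adj u v → c u ≠ c v) ∧
      HasPathDecompWidthLE G (k + 1) ∧
      ∀ (W : Type) (H : SimpleGraph W),
        (∃ f : V → W × ℕ × Fin ℓ, Function.Injective f ∧
          ∀ u v : V, G.Adj u v →
            ((f u).1 = (f v).1 ∨ H.Adj (f u).1 (f v).1) ∧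
            |((f u).2.1 : ℤ) - ((f v).2.1 : ℤ)| ≤ 1) →
        TwoSmallMinor
          (completeJoin (SimpleGraph.pathGraph n) (completeBipartiteGraph (Fin i) (Fin j)))
          H := by
  classical
  obtain ⟨k', hk'⟩ : ∃ k', i + j = k' + 1 := ⟨i + j - 1, by omega⟩
  let e : Fin (k'+1) ≃ Fin i ⊕ Fin j := (finCongr hk'.symm).trans finSumFinEquiv.symm
  let κ : Fin (k'+1) → Bool := fun a => (e a).isLeft
  obtain ⟨V, _, G, col, h1, h2, h3, h4, h5⟩ := good_all n (5*ℓ) k' (0+1) (fun a => κ a.succ)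
  haveI : Nonempty V := ⟨(h3 true).choose⟩
  have hforce := ext_force G col n (5*ℓ) 0 k' κ h5
  have hnoiso := ext_noiso (5*ℓ*0+1) G col (κ 0) h2 h3
  have hproper := ext_proper (5*ℓ*0+1) G col (κ 0) h1
  refine ⟨Fin (5*ℓ*0+1) × Option V, inferInstance, extG (5*ℓ*0+1) G col (κ 0), ?_, ?_, ?_⟩
  · refine ⟨fun v => if extCol _ col (κ 0) v then 1 else 0, fun u v huv => ?_⟩
    have := hproper u v huv
    cases hu : extCol _ col (κ 0) u <;> cases hv : extCol _ col (κ 0) v <;> simp_all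
  · have := ext_pd (5*ℓ*0+1) _ G col (κ 0) h4
    rw [hk, hk']
    exact this
  · rintro W H ⟨f, hf, hadj⟩
    have hone : ∀ a b : Fin (5*ℓ*0+1), a = b := by
      intro a b
      apply Fin.ext
      have := a.isLt
      have := b.isLt
      omega
    have hapex : ∀ v, extCol _ col (κ 0) v ≠ κ 0 →
        (extG (5*ℓ*0+1) G col (κ 0)).Adj v (0, none) := by
      rintro ⟨a, _ | v⟩ hv
      · exact absurd rfl hv
      · exact ⟨hone _ _, hv⟩
    have hlev : ∀ v, |((f v).2.1 : ℤ) - ((f (0, none)).2.1 : ℕ)| ≤ 2 := by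
      intro v
      by_cases hv : extCol _ col (κ 0) v = κ 0
      · obtain ⟨u, hu⟩ := hnoiso v
        have hc := hproper _ _ hu
        have a1 := abs_le.1 (hadj _ _ hu).2
        have a2 := abs_le.1 (hadj _ _ (hapex u (fun h => hc (hv.trans h.symm)))).2
        rw [abs_le]
        omega
      · have a2 := abs_le.1 (hadj _ _ (hapex v hv)).2
        rw [abs_le]
        omega
    obtain ⟨hub, p, c1, c2, s1, s2, i1, i2, i3, g1, g2, g3, g4⟩ := hforce W H (fun v => (f v).1) ∅
      (fun y => fibre_bound ℓ _ f hf hlev y) (fun u v huv => (hadj u v huv).1) (by simp)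
    refine minor_of_force (extG (5*ℓ*0+1) G col (κ 0)) H i j n (fun v => (f v).1)
      (fun u v huv => (hadj u v huv).1) (fun a => a.isLeft) (by simp) (fun a => hub (e.symm a)) p
      ?_ i2 ?_ ?_ ?_ g3 g4
    · intro a a' h
      exact e.symm.injective (i1 _ _ h)
    · intro a r b
      exact i3 _ r b
    · intro a a' h
      exact g1 _ _ (by simpa [κ] using h)
    · intro a r b h
      exact g2 _ r b (by simpa [κ] using h)
end

section
/- For every positive integer ℓ there exists a finite bipartite simple graph G with pathwidth at most 2 such that for every simple graph H: if there is an injective map f : V(G) → V(H) × ℕ × Fin ℓ such that for every edge uv of G, writing f(u) = (x, i, s) and f(v) = (y, j, t), one has (x = y or xy ∈ E(H)) and |i − j| ≤ 1 (i.e. G is isomorphic to a subgraph of H ⊠ P ⊠ K_ℓ for the one-way infinite path P on ℕ), then H contains a cycle of length at most 6. -/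
/-- Pigeonhole: few vertices near layer `c` share the same first coordinate. -/
lemma pigeon_aux {W : Type} (ℓ : ℕ) (x : W) (c : ℕ) (g : Fin (5 * ℓ + 1) → W × ℕ × Fin ℓ)
    (hg : Function.Injective g) (h1 : ∀ r, (g r).1 = x)
    (h2 : ∀ r, |((g r).2.1 : ℤ) - (c : ℤ)| ≤ 2) : False := by
  have hb : ∀ r, (g r).2.1 + 2 - c < 5 := by
    intro r
    have := abs_le.mp (h2 r)
    omega
  let h : Fin (5 * ℓ + 1) → Fin 5 × Fin ℓ := fun r => (⟨(g r).2.1 + 2 - c, hb r⟩, (g r).2.2)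
  have hi : Function.Injective h := by
    intro r s hrs
    simp only [h, Prod.mk.injEq, Fin.mk.injEq] at hrs
    apply hg
    have a := abs_le.mp (h2 r)
    have b := abs_le.mp (h2 s)
    refine Prod.ext ((h1 r).trans (h1 s).symm) (Prod.ext ?_ hrs.2)
    omega
  have := Fintype.card_le_of_injective h hi
  simp at this

/-- Short cycle of length three. -/
lemma cycle_three {W : Type} (H : SimpleGraph W) (a b c : W)
    (hab : H.Adj a b) (hbc : H.Adj b c) (hca : H.Adj c a) :
    ∃ t : ℕ, 3 ≤ t ∧ t ≤ 6 ∧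
      ∃ p : ℕ → W, (∀ a < t, ∀ b < t, p a = p b → a = b) ∧
        ∀ a < t, H.Adj (p a) (p ((a + 1) % t)) := by
  have h1 := hab.ne
  have h2 := hbc.ne
  have h3 := hca.ne
  refine ⟨3, by norm_num, by norm_num, fun i => if i = 0 then a else if i = 1 then b else c, ?_, ?_⟩
  · intro i hi j hj
    interval_cases i <;> interval_cases j <;> simp [h1, h2, h3, h1.symm, h2.symm, h3.symm]
  · intro i hi
    interval_cases i <;> simp [hab, hbc, hca]

/-- Short cycle of length four. -/
lemma cycle_four {W : Type} (H : SimpleGraph W) (a b c d : W)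
    (hab : H.Adj a b) (hbc : H.Adj b c) (hcd : H.Adj c d) (hda : H.Adj d a)
    (hac : a ≠ c) (hbd : b ≠ d) :
    ∃ t : ℕ, 3 ≤ t ∧ t ≤ 6 ∧
      ∃ p : ℕ → W, (∀ a < t, ∀ b < t, p a = p b → a = b) ∧
        ∀ a < t, H.Adj (p a) (p ((a + 1) % t)) := by
  have h1 := hab.ne
  have h2 := hbc.ne
  have h3 := hcd.ne
  have h4 := hda.ne
  refine ⟨4, by norm_num, by norm_num,
    fun i => if i = 0 then a else if i = 1 then b else if i = 2 then c else d, ?_, ?_⟩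
  · intro i hi j hj
    interval_cases i <;> interval_cases j <;>
      simp [h1, h2, h3, h4, hac, hbd, h1.symm, h2.symm, h3.symm, h4.symm, hac.symm, hbd.symm]
  · intro i hi
    interval_cases i <;> simp [hab, hbc, hcd, hda]

/-- The core argument on a long even fan mapped into the product. -/
lemma core_aux_s8 {W : Type} (H : SimpleGraph W) (ℓ M : ℕ) (hM : M = 5 * ℓ + 1) (x : W) (c : ℕ)
    (q : ℕ → W × ℕ × Fin ℓ)
    (hinj : ∀ i < 2 * M * M, ∀ j < 2 * M * M, q i = q j → i = j)
    (hfan : ∀ i, 2 * i < 2 * M * M → (x = (q (2 * i)).1 ∨ H.Adj x (q (2 * i)).1) ∧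
      |((q (2 * i)).2.1 : ℤ) - (c : ℤ)| ≤ 1)
    (hpath : ∀ i, i + 1 < 2 * M * M → ((q i).1 = (q (i + 1)).1 ∨ H.Adj (q i).1 (q (i + 1)).1) ∧
      |((q i).2.1 : ℤ) - ((q (i + 1)).2.1 : ℤ)| ≤ 1) :
    ∃ t : ℕ, 3 ≤ t ∧ t ≤ 6 ∧
      ∃ p : ℕ → W, (∀ a < t, ∀ b < t, p a = p b → a = b) ∧
        ∀ a < t, H.Adj (p a) (p ((a + 1) % t)) := by
  by_contra hno
  have hlayer : ∀ i < 2 * M * M, |((q i).2.1 : ℤ) - (c : ℤ)| ≤ 2 := by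
    intro i hi
    rcases Nat.even_or_odd' i with ⟨k, rfl | rfl⟩
    · have := (hfan k hi).2
      omega
    · have h1 := (hfan k (by omega)).2
      have h2 := (hpath (2 * k) hi).2
      rw [abs_le] at *
      omega
  have hlt : ∀ j < M, ∀ s < 2 * M, 2 * M * j + s < 2 * M * M := by
    intro j hj s hs
    have : 2 * M * (j + 1) ≤ 2 * M * M := Nat.mul_le_mul_left _ hj
    rw [mul_add, mul_one] at this
    omega
  -- some block avoids `x`
  have hblock : ∃ j < M, ∀ s < 2 * M, (q (2 * M * j + s)).1 ≠ x := by
    by_contra hcon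
    push Not at hcon
    choose! s hs hsx using hcon
    subst hM
    refine pigeon_aux ℓ x c (fun j => q (2 * (5 * ℓ + 1) * j.1 + s j.1)) ?_
      (fun j => hsx j.1 j.2) (fun j => hlayer _ (hlt _ j.2 _ (hs _ j.2)))
    intro j k hjk
    have e := hinj _ (hlt _ j.2 _ (hs _ j.2)) _ (hlt _ k.2 _ (hs _ k.2)) hjk
    have e2 := congrArg (fun z => z / (2 * (5 * ℓ + 1))) e
    beta_reduce at e2
    rw [Nat.mul_add_div (by omega), Nat.mul_add_div (by omega),
      Nat.div_eq_of_lt (hs _ j.2), Nat.div_eq_of_lt (hs _ k.2)] at e2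
    exact Fin.ext (by simpa using e2)
  obtain ⟨j, hj, hjx⟩ := hblock
  have hconst : ∀ r < M, (q (2 * M * j + 2 * r)).1 = (q (2 * M * j)).1 := by
    intro r
    induction r with
    | zero => intro _; rfl
    | succ r ih =>
      intro hr
      rw [← ih (by omega)]
      by_contra hne
      have l0 := hlt j hj (2 * r) (by omega)
      have l1 := hlt j hj (2 * r + 1) (by omega)
      have l2 := hlt j hj (2 * r + 2) (by omega)
      have n0 := hjx (2 * r) (by omega)
      have n1 := hjx (2 * r + 1) (by omega)
      have n2 := hjx (2 * r + 2) (by omega)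
      have f0 := (hfan (M * j + r) (by rw [mul_add, ← mul_assoc]; exact l0)).1
      have f2 := (hfan (M * j + r + 1) (by
        have : 2 * (M * j + r + 1) = 2 * M * j + (2 * r + 2) := by ring
        rw [this]; exact l2)).1
      have e0 : 2 * (M * j + r) = 2 * M * j + 2 * r := by ring
      have e2 : 2 * (M * j + r + 1) = 2 * M * j + (2 * r + 2) := by ring
      rw [e0] at f0
      rw [e2] at f2
      have p0 := (hpath (2 * M * j + 2 * r) l1).1
      have p1 := (hpath (2 * M * j + (2 * r + 1)) l2).1
      rw [show 2 * M * j + 2 * r + 1 = 2 * M * j + (2 * r + 1) from rfl] at p0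
      rw [show 2 * M * j + (2 * r + 1) + 1 = 2 * M * j + (2 * r + 2) from rfl] at p1
      rw [show 2 * (r + 1) = 2 * r + 2 from rfl] at hne
      generalize (q (2 * M * j + 2 * r)).1 = y at *
      generalize (q (2 * M * j + (2 * r + 1))).1 = z at *
      generalize (q (2 * M * j + (2 * r + 2))).1 = w at *
      have f0 := f0.resolve_left (Ne.symm n0)
      have f2 := f2.resolve_left (Ne.symm n2)
      rcases p0 with rfl | p0
      · rcases p1 with rfl | p1
        · exact hne rfl
        · exact hno (cycle_three H x y w f0 p1 f2.symm)
      · rcases p1 with rfl | p1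
        · exact hno (cycle_three H x y z f0 p0 f2.symm)
        · exact hno (cycle_four H x y z w f0 p0 p1 f2.symm (Ne.symm n1) (Ne.symm hne))
  subst hM
  refine pigeon_aux ℓ (q (2 * (5 * ℓ + 1) * j)).1 c
    (fun r => q (2 * (5 * ℓ + 1) * j + 2 * r.1)) ?_ (fun r => hconst r.1 r.2)
    (fun r => hlayer _ (hlt _ hj _ (by omega)))
  intro r s hrs
  have e := hinj _ (hlt _ hj _ (by omega)) _ (hlt _ hj _ (by omega)) hrs
  exact Fin.ext (by omega)

/-- Adjacency of the even fan: an apex `none` joined to the even vertices of a path. -/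
def fanRel (n : ℕ) : Option (Fin n) → Option (Fin n) → Prop
  | none, none => False
  | none, some i => i.1 % 2 = 0
  | some i, none => i.1 % 2 = 0
  | some i, some j => i.1 + 1 = j.1 ∨ j.1 + 1 = i.1

/-- The even fan. -/
def fanGraph (n : ℕ) : SimpleGraph (Option (Fin n)) where
  Adj := fanRel n
  symm := ⟨by
    rintro (_ | i) (_ | j) h
    · exact h
    · exact h
    · exact h
    · exact Or.symm h⟩
  loopless := ⟨by
    rintro (_ | i) h
    · exact h
    · simp only [fanRel] at h
      omega⟩

lemma fan_bipartite (n : ℕ) :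
    ∃ c : Option (Fin n) → Fin 2, ∀ u v, (fanGraph n).Adj u v → c u ≠ c v := by
  refine ⟨fun v => match v with
    | none => 1
    | some i => ⟨i.1 % 2, Nat.mod_lt _ (by norm_num)⟩, ?_⟩
  rintro (_ | i) (_ | j) h
  · exact h.elim
  · have h : j.1 % 2 = 0 := h
    simp [h]
  · have h : i.1 % 2 = 0 := h
    simp [h]
  · have h : i.1 + 1 = j.1 ∨ j.1 + 1 = i.1 := h
    simp only [ne_eq, Fin.mk.injEq]
    omega

lemma fan_pathwidth (n : ℕ) (hn : 0 < n) : HasPathDecompWidthLE (fanGraph n) 2 := by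
  classical
  refine ⟨n, fun i => {none, some i, some ⟨min (i.1 + 1) (n - 1), by omega⟩}, ?_, ?_, ?_, ?_⟩
  · rintro (_ | i)
    · exact ⟨⟨0, hn⟩, by simp⟩
    · exact ⟨i, by simp⟩
  · rintro (_ | i) (_ | j) h
    · exact h.elim
    · exact ⟨j, by simp⟩
    · exact ⟨i, by simp⟩
    · have h : i.1 + 1 = j.1 ∨ j.1 + 1 = i.1 := h
      rcases h with h | h
      · refine ⟨i, by simp, ?_⟩
        simp only [Finset.mem_insert, Finset.mem_singleton, Option.some.injEq, Fin.ext_iff]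
        omega
      · refine ⟨j, ?_, by simp⟩
        simp only [Finset.mem_insert, Finset.mem_singleton, Option.some.injEq, Fin.ext_iff]
        omega
  · rintro (_ | v) i j k hij hjk h1 h2
    · simp
    · simp only [Finset.mem_insert, Finset.mem_singleton, Option.some.injEq, Fin.ext_iff,
        reduceCtorEq, false_or, Fin.le_def] at *
      omega
  · intro i
    exact Finset.card_le_three


/-- For all `ℓ ≥ 1` there is a finite bipartite graph `G` of pathwidth at most `2`
such that for every graph `H`: if `G` is isomorphic to a subgraph of `H ⊠ P ⊠ K_ℓ`
(for the one-way infinite path `P` on `ℕ`), then `H` contains a cycle of length at most `6`. -/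
theorem stmt_8 (ℓ : ℕ) (hℓ : 1 ≤ ℓ) :
    ∃ (V : Type) (_ : Fintype V) (G : SimpleGraph V),
      (∃ c : V → Fin 2, ∀ u v : V, G.Adj u v → c u ≠ c v) ∧
      HasPathDecompWidthLE G 2 ∧
      ∀ (W : Type) (H : SimpleGraph W),
        (∃ f : V → W × ℕ × Fin ℓ, Function.Injective f ∧
          ∀ u v : V, G.Adj u v →
            ((f u).1 = (f v).1 ∨ H.Adj (f u).1 (f v).1) ∧
            |((f u).2.1 : ℤ) - ((f v).2.1 : ℤ)| ≤ 1) →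
        ∃ t : ℕ, 3 ≤ t ∧ t ≤ 6 ∧
          ∃ p : ℕ → W, (∀ a < t, ∀ b < t, p a = p b → a = b) ∧
            ∀ a < t, H.Adj (p a) (p ((a + 1) % t)) := by
  have hn : 0 < 2 * (5 * ℓ + 1) * (5 * ℓ + 1) := by positivity
  refine ⟨Option (Fin (2 * (5 * ℓ + 1) * (5 * ℓ + 1))), inferInstance, fanGraph _,
    fan_bipartite _, fan_pathwidth _ hn, ?_⟩
  rintro W H ⟨f, hf, hadj⟩
  refine core_aux_s8 H ℓ (5 * ℓ + 1) rfl (f none).1 (f none).2.1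
    (fun i => if h : i < 2 * (5 * ℓ + 1) * (5 * ℓ + 1) then f (some ⟨i, h⟩) else f none) ?_ ?_ ?_
  · intro i hi j hj h
    simp only [hi, hj, dif_pos] at h
    simpa using hf h
  · intro i hi
    simp only [hi, dif_pos]
    have h1 : (fanGraph (2 * (5 * ℓ + 1) * (5 * ℓ + 1))).Adj none (some ⟨2 * i, hi⟩) := by
      show (2 * i) % 2 = 0
      omega
    have h2 := hadj _ _ h1
    exact ⟨h2.1, (abs_sub_comm _ _).trans_le h2.2⟩
  · intro i hi
    have hi0 : i < 2 * (5 * ℓ + 1) * (5 * ℓ + 1) := by omega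
    simp only [hi, hi0, dif_pos]
    exact hadj (some ⟨i, hi0⟩) (some ⟨i + 1, hi⟩) (Or.inl rfl)
end

section
/- For every positive integer ℓ there exists a finite bipartite simple graph G with pathwidth at most 3 such that for every simple graph H: if there is an injective map f : V(G) → V(H) × ℕ × Fin ℓ such that for every edge uv of G, writing f(u) = (x, i, s) and f(v) = (y, j, t), one has (x = y or xy ∈ E(H)) and |i − j| ≤ 1 (i.e. G is isomorphic to a subgraph of H ⊠ P ⊠ K_ℓ for the one-way infinite path P on ℕ), then the complete graph K_4 is a 2-small minor of H. -/
/-- Vertices of the witness graph. -/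
inductive Vtx (N : ℕ) : Type
  | a : Vtx N
  | b : Fin N → Vtx N
  | p : Fin N → Fin N → Vtx N
  | x : Fin N → Fin N → Fin N → Vtx N

namespace Vtx

def enc {N : ℕ} : Vtx N → Unit ⊕ Fin N ⊕ (Fin N × Fin N) ⊕ (Fin N × Fin N × Fin N)
  | a => Sum.inl ()
  | b j => Sum.inr (Sum.inl j)
  | p j i => Sum.inr (Sum.inr (Sum.inl (j, i)))
  | x j i k => Sum.inr (Sum.inr (Sum.inr (j, i, k)))

theorem enc_inj {N : ℕ} : Function.Injective (enc (N := N)) := by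
  intro u v h
  cases u <;> cases v <;> simp_all [enc]

noncomputable instance {N : ℕ} : Fintype (Vtx N) := Fintype.ofInjective enc enc_inj

/-- Directed edge relation. -/
def rel {N : ℕ} : Vtx N → Vtx N → Prop
  | a, b _ => True
  | a, p _ i => i.1 % 2 = 0
  | a, x _ i _ => i.1 % 2 = 1
  | b j, p j' i => j = j' ∧ i.1 % 2 = 1
  | b j, x j' i _ => j = j' ∧ i.1 % 2 = 0
  | p j i, p j' i' => j = j' ∧ i'.1 = i.1 + 1
  | x j i _, p j' i' => j = j' ∧ i = i'
  | _, _ => False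

def gr (N : ℕ) : SimpleGraph (Vtx N) := SimpleGraph.fromRel rel

def col {N : ℕ} : Vtx N → Fin 2
  | a => 0
  | b _ => 1
  | p _ i => if i.1 % 2 = 0 then 1 else 0
  | x _ i _ => if i.1 % 2 = 0 then 0 else 1

theorem col_rel {N : ℕ} (u v : Vtx N) (h : rel u v) : col u ≠ col v := by
  cases u <;> cases v <;> simp only [rel, col] at h ⊢ <;> (try split_ifs) <;> simp <;> grind

theorem col_adj {N : ℕ} (u v : Vtx N) (h : (gr N).Adj u v) : col u ≠ col v := by
  rw [gr, SimpleGraph.fromRel_adj] at h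
  rcases h.2 with h | h
  · exact col_rel _ _ h
  · exact (col_rel _ _ h).symm

theorem adj_of_rel {N : ℕ} {u v : Vtx N} (h : rel u v) : (gr N).Adj u v := by
  rw [gr, SimpleGraph.fromRel_adj]
  exact ⟨fun e => col_rel _ _ h (by rw [e]), Or.inl h⟩

abbrev Idx (N : ℕ) := Fin N ×ₗ (Fin N ×ₗ Fin (N + 1))

/-- membership in bag `(j, i, k)` -/
def mem {N : ℕ} (j i : Fin N) (k : Fin (N + 1)) : Vtx N → Prop
  | a => True
  | b j' => j' = j
  | p j' i' => j' = j ∧ (i' = i ∨ (k.1 = N ∧ i'.1 = i.1 + 1))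
  | x j' i' k' => j' = j ∧ i' = i ∧ k'.1 = k.1

open Classical in
noncomputable def bag {N : ℕ} (j i : Fin N) (k : Fin (N + 1)) : Finset (Vtx N) :=
  Finset.univ.filter (mem j i k)

open Classical in
theorem bag_card {N : ℕ} (j i : Fin N) (k : Fin (N + 1)) : (bag j i k).card ≤ 4 := by
  obtain ⟨w, hw⟩ : ∃ w : Vtx N, bag j i k ⊆ {a, b j, p j i, w} := by
    by_cases hk : k.1 = N
    · by_cases hi : i.1 + 1 < N
      · refine ⟨p j ⟨i.1 + 1, hi⟩, ?_⟩
        intro v hv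
        simp only [bag, Finset.mem_filter, Finset.mem_univ, true_and] at hv
        cases v <;> simp only [mem] at hv <;> simp [Fin.ext_iff] <;> grind
      · refine ⟨a, ?_⟩
        intro v hv
        simp only [bag, Finset.mem_filter, Finset.mem_univ, true_and] at hv
        cases v <;> simp only [mem] at hv <;> simp [Fin.ext_iff] <;> grind
    · refine ⟨x j i ⟨k.1, by omega⟩, ?_⟩
      intro v hv
      simp only [bag, Finset.mem_filter, Finset.mem_univ, true_and] at hv
      cases v <;> simp only [mem] at hv <;> simp [Fin.ext_iff] <;> grind
  exact (Finset.card_le_card hw).trans Finset.card_le_four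

theorem mem_conv {N : ℕ} (v : Vtx N) (j i j' i' j'' i'' : Fin N) (k k' k'' : Fin (N + 1))
    (h1 : j < j' ∨ j = j' ∧ (i < i' ∨ i = i' ∧ k ≤ k'))
    (h2 : j' < j'' ∨ j' = j'' ∧ (i' < i'' ∨ i' = i'' ∧ k' ≤ k''))
    (h : mem j i k v) (h' : mem j'' i'' k'' v) : mem j' i' k' v := by
  cases v <;> simp only [mem, Fin.ext_iff, Fin.lt_def, Fin.le_def] at * <;> omega

theorem mem_rel {N : ℕ} (hN : 0 < N) (u v : Vtx N) (h : rel u v) :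
    ∃ j i k, mem j i k u ∧ mem j i k v := by
  have z : Fin N := ⟨0, hN⟩
  cases u with
  | a =>
    cases v with
    | a => simp [rel] at h
    | b j => exact ⟨j, z, 0, by simp [mem]⟩
    | p j i => exact ⟨j, i, 0, by simp [mem]⟩
    | x j i k => exact ⟨j, i, k.castSucc, by simp [mem]⟩
  | b j =>
    cases v with
    | a => simp [rel] at h
    | b j => simp [rel] at h
    | p j' i => exact ⟨j', i, 0, by simp_all [mem, rel]⟩
    | x j' i k => exact ⟨j', i, k.castSucc, by simp_all [mem, rel]⟩
  | p j i =>
    cases v with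
    | p j' i' => exact ⟨j, i, Fin.last N, by simp_all [mem, rel]⟩
    | a => simp [rel] at h
    | b j => simp [rel] at h
    | x j' i k => simp [rel] at h
  | x j i k =>
    cases v with
    | p j' i' => exact ⟨j, i, k.castSucc, by simp_all [mem, rel]⟩
    | a => simp [rel] at h
    | b j => simp [rel] at h
    | x j' i k => simp [rel] at h

theorem mem_ex {N : ℕ} (hN : 0 < N) (v : Vtx N) : ∃ j i k, mem j i k v := by
  have z : Fin N := ⟨0, hN⟩
  cases v with
  | a => exact ⟨z, z, 0, by simp [mem]⟩
  | b j => exact ⟨j, z, 0, by simp [mem]⟩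
  | p j i => exact ⟨j, i, 0, by simp [mem]⟩
  | x j i k => exact ⟨j, i, k.castSucc, by simp [mem]⟩

theorem pathdec {N : ℕ} (hN : 0 < N) : HasPathDecompWidthLE (gr N) 3 := by
  let e : Fin (Fintype.card (Idx N)) ≃o Idx N := Fintype.orderIsoFinOfCardEq _ rfl
  let B : Idx N → Finset (Vtx N) := fun t => bag (ofLex t).1 (ofLex (ofLex t).2).1 (ofLex (ofLex t).2).2
  have hB : ∀ v t, v ∈ B t ↔ mem (ofLex t).1 (ofLex (ofLex t).2).1 (ofLex (ofLex t).2).2 v := by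
    intro v t
    simp [B, bag]
  have hmk : ∀ j i k, ∃ s, ∀ v, v ∈ B (e s) ↔ mem j i k v := by
    intro j i k
    refine ⟨e.symm (toLex (j, toLex (i, k))), fun v => ?_⟩
    rw [hB, OrderIso.apply_symm_apply]
    rfl
  refine ⟨_, fun s => B (e s), ?_, ?_, ?_, ?_⟩
  · intro v
    obtain ⟨j, i, k, h⟩ := mem_ex hN v
    obtain ⟨s, hs⟩ := hmk j i k
    exact ⟨s, (hs v).2 h⟩
  · intro u v h
    rw [gr, SimpleGraph.fromRel_adj] at h
    rcases h.2 with h | h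
    · obtain ⟨j, i, k, h1, h2⟩ := mem_rel hN _ _ h
      obtain ⟨s, hs⟩ := hmk j i k
      exact ⟨s, (hs _).2 h1, (hs _).2 h2⟩
    · obtain ⟨j, i, k, h1, h2⟩ := mem_rel hN _ _ h
      obtain ⟨s, hs⟩ := hmk j i k
      exact ⟨s, (hs _).2 h2, (hs _).2 h1⟩
  · intro v r s t hrs hst hr ht
    have h1 := e.monotone hrs
    have h2 := e.monotone hst
    rw [hB] at *
    rw [Prod.Lex.le_iff, Prod.Lex.le_iff] at h1 h2
    exact mem_conv v _ _ _ _ _ _ _ _ _ h1 h2 hr ht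
  · intro s
    exact bag_card _ _ _

end Vtx

theorem k4_of {W : Type} (H : SimpleGraph W) (A B C D X Y : W)
    (hAB : H.Adj A B) (hAC : H.Adj A C) (hBD : H.Adj B D) (hCD : H.Adj C D)
    (hAX : H.Adj A X) (hXD : H.Adj X D) (hBY : H.Adj B Y) (hYC : H.Adj Y C)
    (hAD : A ≠ D) (hBC : B ≠ C) (hXB : X ≠ B) (hXC : X ≠ C)
    (hYA : Y ≠ A) (hYD : Y ≠ D) (hYX : Y ≠ X) :
    TwoSmallMinor (⊤ : SimpleGraph (Fin 4)) H := by
  have := hAB.ne; have := hAC.ne; have := hBD.ne; have := hCD.ne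
  have := hAX.ne; have := hXD.ne; have := hBY.ne; have := hYC.ne
  refine ⟨![H.subgraphOfAdj hAX, H.subgraphOfAdj hBY, H.singletonSubgraph C,
    H.singletonSubgraph D], ?_, ?_, ?_, ?_, ?_⟩
  · intro u
    fin_cases u <;> simp
  · intro u
    fin_cases u
    · exact SimpleGraph.Subgraph.subgraphOfAdj_connected hAX
    · exact SimpleGraph.Subgraph.subgraphOfAdj_connected hBY
    · exact SimpleGraph.Subgraph.singletonSubgraph_connected
    · exact SimpleGraph.Subgraph.singletonSubgraph_connected
  · intro u v huv
    fin_cases u <;> fin_cases v <;> simp_all [eq_comm]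
  · intro u v huv
    have := hAB.symm; have := hAC.symm; have := hBD.symm; have := hCD.symm
    have := hXD.symm; have := hYC.symm
    fin_cases u <;> fin_cases v <;> simp_all
  · intro u
    fin_cases u
    · simpa [Set.ncard_singleton] using Set.ncard_insert_le A {X}
    · simpa [Set.ncard_singleton] using Set.ncard_insert_le B {Y}
    · simp
    · simp

open Classical in
theorem fresh {V W : Type} (g : V → W) (M : ℕ)
    (hg : ∀ (w : W) (S : Finset V), (∀ v ∈ S, g v = w) → S.card ≤ M)
    {n : ℕ} (φ : Fin n → V) (hφ : Function.Injective φ) (T : Finset W) (hT : M * T.card < n) :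
    ∃ i, g (φ i) ∉ T := by
  by_contra hcon
  push Not at hcon
  have h := Finset.card_le_mul_card_image_of_maps_to (f := fun i => g (φ i)) (s := Finset.univ)
    (t := T) (fun i _ => hcon i) M (by
      intro w _
      rw [← Finset.card_image_of_injective _ hφ]
      apply hg w
      intro v hv
      simp only [Finset.mem_image, Finset.mem_filter] at hv
      obtain ⟨i, hi, rfl⟩ := hv
      exact hi.2)
  simp at h
  omega

theorem small {V W : Type} (ℓ : ℕ) (f : V → W × ℕ × Fin ℓ) (hf : Function.Injective f) (h0 : ℕ)
    (hh : ∀ v, |((f v).2.1 : ℤ) - h0| ≤ 3) (w : W) (S : Finset V)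
    (hS : ∀ v ∈ S, (f v).1 = w) : S.card ≤ 7 * ℓ := by
  have h := Finset.card_le_card_of_injOn (s := S)
    (t := (Finset.Icc (h0 - 3) (h0 + 3)) ×ˢ (Finset.univ : Finset (Fin ℓ)))
    (fun v => (f v).2) (by
      intro v _
      have := abs_le.1 (hh v)
      simp
      omega) (by
      intro u hu v hv huv
      apply hf
      exact Prod.ext ((hS u hu).trans (hS v hv).symm) huv)
  rw [Finset.card_product] at h
  simp only [Nat.card_Icc, Finset.card_univ, Fintype.card_fin] at h
  exact h.trans (Nat.mul_le_mul_right _ (by omega))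

/-- In a long sequence with bounded multiplicities there is a consecutive pair of distinct
values avoiding a set of two values. -/
theorem consec {V W : Type} (g : V → W) (M : ℕ)
    (hg : ∀ (w : W) (S : Finset V), (∀ v ∈ S, g v = w) → S.card ≤ M)
    {N : ℕ} (hN : (2 * M + 1) * (M + 1) ≤ N) (q : Fin N → V) (hq : Function.Injective q)
    (A B : W) :
    ∃ i i' : Fin N, i'.1 = i.1 + 1 ∧ g (q i) ≠ g (q i') ∧ g (q i) ≠ A ∧ g (q i) ≠ B ∧
      g (q i') ≠ A ∧ g (q i') ≠ B := by
  classical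
  have hlt : ∀ (s : Fin (2 * M + 1)) (r : Fin (M + 1)), s.1 * (M + 1) + r.1 < N := by
    intro s r
    have h1 : (s.1 + 1) * (M + 1) ≤ (2 * M + 1) * (M + 1) := Nat.mul_le_mul_right _ s.2
    have := r.2
    have h2 : (s.1 + 1) * (M + 1) = s.1 * (M + 1) + (M + 1) := by ring
    omega
  obtain ⟨s, hs⟩ : ∃ s : Fin (2 * M + 1), ∀ r : Fin (M + 1),
      g (q ⟨s.1 * (M + 1) + r.1, hlt s r⟩) ∉ ({A, B} : Finset W) := by
    by_contra hcon
    push Not at hcon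
    choose r hr using hcon
    obtain ⟨s, hs⟩ := fresh g M hg (fun s => q ⟨s.1 * (M + 1) + (r s).1, hlt s (r s)⟩) (by
      intro s t hst
      have h1 := congrArg Fin.val (hq hst)
      simp only at h1
      have h2 : ∀ s : Fin (2 * M + 1), (s.1 * (M + 1) + (r s).1) / (M + 1) = s.1 := by
        intro s
        rw [mul_comm, Nat.mul_add_div (by omega), Nat.div_eq_of_lt (r s).2, add_zero]
      apply Fin.ext
      rw [← h2 s, ← h2 t, h1]) {A, B} (by
        have : ({A, B} : Finset W).card ≤ 2 := Finset.card_le_two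
        nlinarith)
    exact hs (hr s)
  by_contra hcon
  push Not at hcon
  have hconst : ∀ (n : ℕ) (hn : n < M + 1), g (q ⟨s.1 * (M + 1) + n, hlt s ⟨n, hn⟩⟩) =
      g (q ⟨s.1 * (M + 1) + 0, hlt s ⟨0, by omega⟩⟩) := by
    intro n
    induction n with
    | zero => intro _; rfl
    | succ n ih =>
      intro hn
      rw [← ih (by omega)]
      by_contra hne
      have h1 := hs ⟨n, by omega⟩
      have h2 := hs ⟨n + 1, hn⟩
      simp only [Finset.mem_insert, Finset.mem_singleton, not_or] at h1 h2
      exact h2.2 (hcon ⟨s.1 * (M + 1) + n, hlt s ⟨n, by omega⟩⟩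
        ⟨s.1 * (M + 1) + (n + 1), hlt s ⟨n + 1, hn⟩⟩ rfl (fun e => hne e.symm) h1.1 h1.2 h2.1)
  obtain ⟨r, hr⟩ := fresh g M hg
    (fun r : Fin (M + 1) => q ⟨s.1 * (M + 1) + r.1, hlt s r⟩) (by
      intro r t hrt
      have h1 := congrArg Fin.val (hq hrt)
      simp only at h1
      apply Fin.ext
      omega) {g (q ⟨s.1 * (M + 1) + 0, hlt s ⟨0, by omega⟩⟩)} (by simp)
  exact hr (by simpa using hconst r.1 r.2)

/-- For all `ℓ ≥ 1` there is a finite bipartite graph `G` of pathwidth at most `3`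
such that for every graph `H`: if `G` is isomorphic to a subgraph of `H ⊠ P ⊠ K_ℓ`
(for the one-way infinite path `P` on `ℕ`), then `K_4` is a `2`-small minor of `H`. -/
theorem stmt_9 (ℓ : ℕ) (hℓ : 1 ≤ ℓ) :
    ∃ (V : Type) (_ : Fintype V) (G : SimpleGraph V),
      (∃ c : V → Fin 2, ∀ u v : V, G.Adj u v → c u ≠ c v) ∧
      HasPathDecompWidthLE G 3 ∧
      ∀ (W : Type) (H : SimpleGraph W),
        (∃ f : V → W × ℕ × Fin ℓ, Function.Injective f ∧
          ∀ u v : V, G.Adj u v →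
            ((f u).1 = (f v).1 ∨ H.Adj (f u).1 (f v).1) ∧
            |((f u).2.1 : ℤ) - ((f v).2.1 : ℤ)| ≤ 1) →
        TwoSmallMinor (⊤ : SimpleGraph (Fin 4)) H := by
  classical
  set M := 7 * ℓ with hM
  set N := (2 * M + 1) * (M + 1) + 5 * M + 1 with hNdef
  have hN0 : 0 < N := by omega
  refine ⟨Vtx N, inferInstance, Vtx.gr N, ⟨Vtx.col, Vtx.col_adj⟩, Vtx.pathdec hN0, ?_⟩
  rintro W H ⟨f, hf, hadj⟩
  have hl : ∀ {u v : Vtx N}, Vtx.rel u v → |((f u).2.1 : ℤ) - ((f v).2.1 : ℤ)| ≤ 1 :=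
    fun h => (hadj _ _ (Vtx.adj_of_rel h)).2
  have hH : ∀ {u v : Vtx N}, Vtx.rel u v → (f u).1 ≠ (f v).1 → H.Adj (f u).1 (f v).1 :=
    fun h hne => (hadj _ _ (Vtx.adj_of_rel h)).1.resolve_left hne
  have hlay : ∀ v, |((f v).2.1 : ℤ) - (f Vtx.a).2.1| ≤ 3 := by
    have hb : ∀ j, |((f (Vtx.b j)).2.1 : ℤ) - (f Vtx.a).2.1| ≤ 1 := by
      intro j
      have h := hl (u := Vtx.a) (v := Vtx.b j) trivial
      rwa [abs_sub_comm]
    intro v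
    cases v with
    | a => simp
    | b j => exact (hb j).trans (by norm_num)
    | p j i =>
      rcases Nat.mod_two_eq_zero_or_one i.1 with h | h
      · have h1 := abs_le.1 (hl (u := Vtx.a) (v := Vtx.p j i) h)
        rw [abs_le]; constructor <;> linarith [h1.1, h1.2]
      · have h1 := abs_le.1 (hl (u := Vtx.b j) (v := Vtx.p j i) ⟨rfl, h⟩)
        have h2 := abs_le.1 (hb j)
        rw [abs_le]; constructor <;> linarith [h1.1, h1.2, h2.1, h2.2]
    | x j i k =>
      rcases Nat.mod_two_eq_zero_or_one i.1 with h | h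
      · have h1 := abs_le.1 (hl (u := Vtx.b j) (v := Vtx.x j i k) ⟨rfl, h⟩)
        have h2 := abs_le.1 (hb j)
        rw [abs_le]; constructor <;> linarith [h1.1, h1.2, h2.1, h2.2]
      · have h1 := abs_le.1 (hl (u := Vtx.a) (v := Vtx.x j i k) h)
        rw [abs_le]; constructor <;> linarith [h1.1, h1.2]
  set g : Vtx N → W := fun v => (f v).1 with hgdef
  have hg : ∀ (w : W) (S : Finset (Vtx N)), (∀ v ∈ S, g v = w) → S.card ≤ M :=
    fun w S hS => small ℓ f hf _ hlay w S hS
  obtain ⟨j, hj⟩ := fresh g M hg (fun j : Fin N => Vtx.b j) (fun _ _ h => by simpa using h)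
    {g Vtx.a} (by simp; omega)
  simp only [Finset.mem_singleton] at hj
  obtain ⟨e, o, he, ho, hre, hCD, hCA, hCB, hDA, hDB⟩ : ∃ e o : Fin N, e.1 % 2 = 0 ∧ o.1 % 2 = 1 ∧
      (o.1 = e.1 + 1 ∨ e.1 = o.1 + 1) ∧ g (Vtx.p j e) ≠ g (Vtx.p j o) ∧
      g (Vtx.p j e) ≠ g Vtx.a ∧ g (Vtx.p j e) ≠ g (Vtx.b j) ∧
      g (Vtx.p j o) ≠ g Vtx.a ∧ g (Vtx.p j o) ≠ g (Vtx.b j) := by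
    obtain ⟨i, i', hi, h1, h2, h3, h4, h5⟩ := consec g M hg (N := N) (by omega)
      (fun i => Vtx.p j i) (fun _ _ h => by simpa using h) (g Vtx.a) (g (Vtx.b j))
    rcases Nat.mod_two_eq_zero_or_one i.1 with h | h
    · exact ⟨i, i', h, by omega, Or.inl hi, h1, h2, h3, h4, h5⟩
    · exact ⟨i', i, by omega, h, Or.inr hi, h1.symm, h4, h5, h2, h3⟩
  have hCDadj : H.Adj (g (Vtx.p j e)) (g (Vtx.p j o)) := by
    rcases hre with h | h
    · exact hH (u := Vtx.p j e) (v := Vtx.p j o) ⟨rfl, h⟩ hCD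
    · exact (hH (u := Vtx.p j o) (v := Vtx.p j e) ⟨rfl, h⟩ hCD.symm).symm
  obtain ⟨k, hk⟩ := fresh g M hg (fun k : Fin N => Vtx.x j o k) (fun _ _ h => by simpa using h)
    {g Vtx.a, g (Vtx.b j), g (Vtx.p j e), g (Vtx.p j o)} (by
      have := Nat.mul_le_mul_left M (Finset.card_le_four
        (a := g Vtx.a) (b := g (Vtx.b j)) (c := g (Vtx.p j e)) (d := g (Vtx.p j o)))
      omega)
  obtain ⟨k', hk'⟩ := fresh g M hg (fun k : Fin N => Vtx.x j e k) (fun _ _ h => by simpa using h)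
    {g (Vtx.x j o k), g Vtx.a, g (Vtx.b j), g (Vtx.p j e), g (Vtx.p j o)} (by
      have := Nat.mul_le_mul_left M (Finset.card_le_five (a := g (Vtx.x j o k))
        (b := g Vtx.a) (c := g (Vtx.b j)) (d := g (Vtx.p j e)) (e := g (Vtx.p j o)))
      omega)
  simp only [Finset.mem_insert, Finset.mem_singleton, not_or] at hk hk'
  obtain ⟨x1, x2, x3, x4⟩ := hk
  obtain ⟨y0, y1, y2, y3, y4⟩ := hk'
  refine k4_of H (g Vtx.a) (g (Vtx.b j)) (g (Vtx.p j e)) (g (Vtx.p j o))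
    (g (Vtx.x j o k)) (g (Vtx.x j e k')) ?_ ?_ ?_ hCDadj ?_ ?_ ?_ ?_
    hDA.symm hCB.symm x2 x3 y1 y4 y0
  · exact hH (u := Vtx.a) (v := Vtx.b j) trivial (Ne.symm hj)
  · exact hH (u := Vtx.a) (v := Vtx.p j e) he hCA.symm
  · exact hH (u := Vtx.b j) (v := Vtx.p j o) ⟨rfl, ho⟩ hDB.symm
  · exact hH (u := Vtx.a) (v := Vtx.x j o k) ho (Ne.symm x1)
  · exact hH (u := Vtx.x j o k) (v := Vtx.p j o) ⟨rfl, rfl⟩ x4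
  · exact hH (u := Vtx.b j) (v := Vtx.x j e k') ⟨rfl, he⟩ (Ne.symm y2)
  · exact hH (u := Vtx.x j e k') (v := Vtx.p j e) ⟨rfl, rfl⟩ y3
end
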